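/- Let M be a MAG and P its PAG (so M ∈ [P]), and let X, Y, Z be pairwise disjoint node sets with X and Y nonempty. Suppose P is adjustment amenable relative to (X,Y) and Z ∩ Forb(X,Y,P) = ∅. Let p be a shortest proper non-causal path from X to Y that is m-connecting given Z in M, such that no equally short such path has a shorter distance-from-Z than p, and let p* denote the path in P constituted by the same sequence of nodes. Then p* is a proper definite status non-causal path from X to Y that is m-connecting given Z in P. -/

import Mathlib

open scoped Classical

/-- Edge marks: tail, arrowhead, circle. -/
inductive Mark : Type
  | tail
  | arrow
  | circle
  deriving DecidableEq

/-- A partial mixed graph over a node set `V`: any two distinct nodes are joined by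
at most one edge; `mark a b` is the mark at `b` on the edge between `a` and `b`
(`none` if there is no edge). -/
structure PMG (V : Type) where
  mark : V → V → Option Mark
  symm : ∀ a b, (mark a b).isSome ↔ (mark b a).isSome
  irrefl : ∀ a, mark a a = none

namespace PMG

variable {V : Type}

/-- `a` and `b` are adjacent. -/
def Adj (G : PMG V) (a b : V) : Prop := (G.mark a b).isSome

/-- directed edge `a → b`. -/
def DirEdge (G : PMG V) (a b : V) : Prop :=
  G.mark a b = some Mark.arrow ∧ G.mark b a = some Mark.tail

/-- bidirected edge `a ↔ b`. -/
def BidirEdge (G : PMG V) (a b : V) : Prop :=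
  G.mark a b = some Mark.arrow ∧ G.mark b a = some Mark.arrow

/-- non-directed edge `a o-o b`. -/
def NondirEdge (G : PMG V) (a b : V) : Prop :=
  G.mark a b = some Mark.circle ∧ G.mark b a = some Mark.circle

/-- A path: a nonempty list of distinct nodes in which successive nodes are adjacent. -/
def IsPath (G : PMG V) (p : List V) : Prop :=
  p ≠ [] ∧ p.Nodup ∧ p.Chain' G.Adj

/-- A path from `a` to `b` (with at least one edge). -/
def IsPathFromTo (G : PMG V) (p : List V) (a b : V) : Prop :=
  IsPath G p ∧ p.head? = some a ∧ p.getLast? = some b ∧ 2 ≤ p.length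

/-- All edges on `p` are directed towards the end of `p`. -/
def DirectedAlong (G : PMG V) (p : List V) : Prop :=
  ∀ i a b, p[i]? = some a → p[i+1]? = some b → G.DirEdge a b

/-- No edge on `p` has an arrowhead at its endpoint closer to the start of `p`
(`p` is possibly directed). -/
def PossDirAlong (G : PMG V) (p : List V) : Prop :=
  ∀ i a b, p[i]? = some a → p[i+1]? = some b → G.mark b a ≠ some Mark.arrow

/-- `b` is a descendant of `a`: a directed path (possibly of length 0) from `a` to `b`. -/
def Descendant (G : PMG V) (a b : V) : Prop :=
  ∃ p, IsPath G p ∧ DirectedAlong G p ∧ p.head? = some a ∧ p.getLast? = some b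

/-- `b` is a possible descendant of `a`. -/
def PossDescendant (G : PMG V) (a b : V) : Prop :=
  ∃ p, IsPath G p ∧ PossDirAlong G p ∧ p.head? = some a ∧ p.getLast? = some b

/-- The node at position `i+1` of `p` is a collider on `p`. -/
def ColliderAt (G : PMG V) (p : List V) (i : ℕ) : Prop :=
  ∃ a b c, p[i]? = some a ∧ p[i+1]? = some b ∧ p[i+2]? = some c ∧
    G.mark a b = some Mark.arrow ∧ G.mark c b = some Mark.arrow

/-- The node at position `i+1` of `p` is a definite non-collider on `p`. -/
def DefNonColliderAt (G : PMG V) (p : List V) (i : ℕ) : Prop :=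
  ∃ a b c, p[i]? = some a ∧ p[i+1]? = some b ∧ p[i+2]? = some c ∧
    (G.mark a b = some Mark.tail ∨ G.mark c b = some Mark.tail ∨
      (G.mark a b = some Mark.circle ∧ G.mark c b = some Mark.circle ∧ ¬ G.Adj a c))

/-- `p` is of definite status. -/
def DefStatus (G : PMG V) (p : List V) : Prop :=
  ∀ i, i + 2 < p.length → (ColliderAt G p i ∨ DefNonColliderAt G p i)

/-- `p` is a definite status path that is m-connecting given `Z`. -/
def MConn (G : PMG V) (Z : Finset V) (p : List V) : Prop :=
  DefStatus G p ∧
  (∀ i b, p[i+1]? = some b → DefNonColliderAt G p i → b ∉ Z) ∧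
  (∀ i b, p[i+1]? = some b → ColliderAt G p i → ∃ z ∈ Z, Descendant G b z)

/-- `a` and `b` are m-separated given `Z`: every definite status path between them
is blocked by `Z`. -/
def MSep (G : PMG V) (a b : V) (Z : Finset V) : Prop :=
  ∀ p, IsPathFromTo G p a b → ¬ MConn G Z p

/-- Two graphs have the same m-separation relations. -/
def MarkovEquiv (G H : PMG V) : Prop :=
  ∀ a b (Z : Finset V), a ≠ b → a ∉ Z → b ∉ Z → (MSep G a b Z ↔ MSep H a b Z)

/-- `G` is a DAG: all edges directed and no directed cycle. -/
def IsDAG (G : PMG V) : Prop :=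
  (∀ a b, G.Adj a b → G.DirEdge a b ∨ G.DirEdge b a) ∧
  (∀ a b, Descendant G a b → Descendant G b a → a = b)

/-- A mixed graph: edges only `→` or `↔`. -/
def IsMixed (G : PMG V) : Prop :=
  ∀ a b, G.Adj a b → G.DirEdge a b ∨ G.DirEdge b a ∨ G.BidirEdge a b

/-- Ancestral mixed graph: no directed cycle, no almost directed cycle. -/
def IsAncestral (G : PMG V) : Prop :=
  IsMixed G ∧ (∀ a b, Descendant G a b → Descendant G b a → a = b) ∧
  (∀ a b, Descendant G a b → ¬ G.BidirEdge b a)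

/-- Maximal ancestral graph. -/
def IsMAG (G : PMG V) : Prop :=
  IsAncestral G ∧ ∀ a b : V, a ≠ b → ¬ G.Adj a b →
    ∃ Z : Finset V, a ∉ Z ∧ b ∉ Z ∧ MSep G a b Z

/-- A collider path from `v` to `x` that is into `x` and all of whose
non-endpoint nodes are parents of `y`. -/
def ColliderPathInto (G : PMG V) (v x y : V) : Prop :=
  ∃ p : List V, IsPathFromTo G p v x ∧
    (∀ i, i + 2 < p.length → ColliderAt G p i) ∧
    (∃ a, p[p.length - 2]? = some a ∧ G.mark a x = some Mark.arrow) ∧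
    (∀ c ∈ p, c ≠ v → c ≠ x → G.DirEdge c y)

/-- The directed edge `x → y` is visible (in a MAG or PAG). -/
def Visible (G : PMG V) (x y : V) : Prop :=
  G.DirEdge x y ∧
  ∃ v, v ≠ y ∧ ¬ G.Adj v y ∧
    (G.mark v x = some Mark.arrow ∨ ColliderPathInto G v x y)

/-- `p` is a proper path from the node set `X` to the node set `Y`. -/
def ProperPath (G : PMG V) (X Y : Finset V) (p : List V) : Prop :=
  IsPath G p ∧ (∃ a ∈ X, p.head? = some a) ∧ (∃ b ∈ Y, p.getLast? = some b) ∧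
  (∀ c ∈ p.tail, c ∉ X)

/-- `p` starts with an edge satisfying `vis` out of its first node. -/
def StartsVisible (vis : V → V → Prop) (p : List V) : Prop :=
  ∃ a b, p[0]? = some a ∧ p[1]? = some b ∧ vis a b

/-- Adjustment amenability relative to `(X,Y)`, with visibility predicate `vis`. -/
def Amenable (G : PMG V) (vis : V → V → Prop) (X Y : Finset V) : Prop :=
  ∀ p, ProperPath G X Y p → PossDirAlong G p → StartsVisible vis p

/-- Forbidden nodes: possible descendants of a node `w ∉ X` lying on a proper
possibly causal path from `X` to `Y`. -/
def Forb (G : PMG V) (X Y : Finset V) : Set V :=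
  { v | ∃ w, w ∉ X ∧
      (∃ p, ProperPath G X Y p ∧ PossDirAlong G p ∧ w ∈ p) ∧
      PossDescendant G w v }

/-- Forbidden nodes in a DAG or MAG: descendants of a node `w ∉ X` lying on a
proper causal path from `X` to `Y`. -/
def ForbD (G : PMG V) (X Y : Finset V) : Set V :=
  { v | ∃ w, w ∉ X ∧
      (∃ p, ProperPath G X Y p ∧ DirectedAlong G p ∧ w ∈ p) ∧
      Descendant G w v }

/-- The generalized adjustment criterion (GAC) relative to `(X,Y)`, with
visibility predicate `vis`. -/
def GAC (G : PMG V) (vis : V → V → Prop) (X Y Z : Finset V) : Prop :=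
  Amenable G vis X Y ∧
  (∀ z ∈ Z, z ∉ Forb G X Y) ∧
  (∀ p, ProperPath G X Y p → DefStatus G p → ¬ PossDirAlong G p → ¬ MConn G Z p)

/-- The adjustment criterion (AC) for DAGs and MAGs relative to `(X,Y)`, with
visibility predicate `vis`. -/
def AC (H : PMG V) (vis : V → V → Prop) (X Y Z : Finset V) : Prop :=
  (∀ p, ProperPath H X Y p → DirectedAlong H p → StartsVisible vis p) ∧
  (∀ z ∈ Z, z ∉ ForbD H X Y) ∧
  (∀ p, ProperPath H X Y p → ¬ PossDirAlong H p → ¬ MConn H Z p)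

/-- `cls` is the Markov equivalence class of DAGs represented by the CPDAG `G`. -/
def IsCPDAGOf (G : PMG V) (cls : Set (PMG V)) : Prop :=
  cls.Nonempty ∧
  (∀ D ∈ cls, IsDAG D) ∧
  (∀ D ∈ cls, ∀ D', IsDAG D' → MarkovEquiv D D' → D' ∈ cls) ∧
  (∀ D ∈ cls, ∀ D' ∈ cls, MarkovEquiv D D') ∧
  (∀ D ∈ cls, ∀ a b, G.Adj a b ↔ D.Adj a b) ∧
  (∀ a b, G.Adj a b → (G.DirEdge a b ∨ G.NondirEdge a b)) ∧
  (∀ a b, G.DirEdge a b ↔ (G.Adj a b ∧ ∀ D ∈ cls, D.DirEdge a b))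

/-- `cls` is the Markov equivalence class of MAGs represented by the PAG `P`. -/
def IsPAGOf (P : PMG V) (cls : Set (PMG V)) : Prop :=
  cls.Nonempty ∧
  (∀ M ∈ cls, IsMAG M) ∧
  (∀ M ∈ cls, ∀ M', IsMAG M' → MarkovEquiv M M' → M' ∈ cls) ∧
  (∀ M ∈ cls, ∀ M' ∈ cls, MarkovEquiv M M') ∧
  (∀ M ∈ cls, ∀ a b, P.Adj a b ↔ M.Adj a b) ∧
  (∀ a b, P.mark a b = some Mark.arrow ↔ (P.Adj a b ∧ ∀ M ∈ cls, M.mark a b = some Mark.arrow)) ∧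
  (∀ a b, P.mark a b = some Mark.tail ↔ (P.Adj a b ∧ ∀ M ∈ cls, M.mark a b = some Mark.tail))

section Density

variable {Ω : Type} [Fintype V] [DecidableEq V] [Fintype Ω]

/-- `f` is a probability density (pmf) over the joint state space. -/
def IsDensity (f : (V → Ω) → ℝ) : Prop :=
  (∀ v, 0 ≤ f v) ∧ ∑ v, f v = 1

/-- The marginal density of the variables in `S`, evaluated at `v`. -/
noncomputable def margOn (f : (V → Ω) → ℝ) (S : Finset V) (v : V → Ω) : ℝ :=
  ∑ w : V → Ω, if ∀ i ∈ S, w i = v i then f w else 0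

/-- The conditional density of the variables in `A` given those in `B`, at `v`. -/
noncomputable def condOn (f : (V → Ω) → ℝ) (A B : Finset V) (v : V → Ω) : ℝ :=
  margOn f (A ∪ B) v / margOn f B v

/-- The parents of `i` in `G`. -/
noncomputable def parents (G : PMG V) (i : V) : Finset V :=
  Finset.univ.filter (fun j => G.DirEdge j i)

/-- `f` factorizes according to the DAG `G`. -/
def ConsistentWith (G : PMG V) (f : (V → Ω) → ℝ) : Prop :=
  ∀ v, f v = ∏ i, condOn f {i} (parents G i) v

/-- The post-intervention density `f(· | do(X = xval))` (truncated factorization). -/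
noncomputable def doDens (G : PMG V) (f : (V → Ω) → ℝ) (X : Finset V) (xval : V → Ω) :
    (V → Ω) → ℝ :=
  fun v => if ∀ i ∈ X, v i = xval i then ∏ i ∈ Xᶜ, condOn f {i} (parents G i) v else 0

/-- Overwrite `v` on `Z` by the assignment `w`. -/
noncomputable def patch (Z : Finset V) (v : V → Ω) (w : {i // i ∈ Z} → Ω) : V → Ω :=
  fun i => if h : i ∈ Z then w ⟨i, h⟩ else v i

end Density

/-- `Z` is an adjustment set relative to `(X,Y)` in the DAG `D`: for every finite state
space and every density consistent with `D`, the adjustment formula holds. -/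
def IsAdjSetDAG [Fintype V] [DecidableEq V] (D : PMG V) (X Y Z : Finset V) : Prop :=
  ∀ (Ω : Type) [Fintype Ω] [DecidableEq Ω] (f : (V → Ω) → ℝ),
    IsDensity f → ConsistentWith D f →
    ∀ v : V → Ω,
      margOn (doDens D f X v) Y v =
        if Z = ∅ then condOn f Y X v
        else ∑ w : ({i // i ∈ Z} → Ω),
          condOn f Y (X ∪ Z) (patch Z v w) * margOn f Z (patch Z v w)

/-- The marginal of a density over `V ⊕ L` on the observed variables `V`. -/
noncomputable def obsMargin {L : Type} [Fintype V] [Fintype L] [DecidableEq V] [DecidableEq L]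
    {Ω : Type} [Fintype Ω] (f : ((V ⊕ L) → Ω) → ℝ) : (V → Ω) → ℝ :=
  fun v => ∑ w : (V ⊕ L) → Ω, if ∀ i : V, w (Sum.inl i) = v i then f w else 0

/-- `M` is the MAG over the observed variables `V` of the DAG `D'` over `V ⊕ L`. -/
def IsMAGOverObs {L : Type} (D' : PMG (V ⊕ L)) (M : PMG V) : Prop :=
  (∀ a b : V, M.Adj a b ↔ (a ≠ b ∧ ∀ S : Finset V, a ∉ S → b ∉ S →
      ¬ MSep D' (Sum.inl a) (Sum.inl b) (S.image Sum.inl))) ∧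
  (∀ a b : V, M.Adj a b →
    ((M.mark a b = some Mark.arrow ↔ ¬ Descendant D' (Sum.inl b) (Sum.inl a)) ∧
     (M.mark a b = some Mark.tail ↔ Descendant D' (Sum.inl b) (Sum.inl a))))

/-- `Z` is an adjustment set relative to `(X,Y)` in the MAG `M`: for every DAG `D'`
with latent variables whose MAG over `V` is `M` and every consistent density,
the adjustment formula holds for the observed margin. -/
def IsAdjSetMAG [Fintype V] [DecidableEq V] (M : PMG V) (X Y Z : Finset V) : Prop :=
  ∀ (Ω L : Type) [Fintype Ω] [DecidableEq Ω] [Fintype L] [DecidableEq L]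
    (D' : PMG (V ⊕ L)) (f' : ((V ⊕ L) → Ω) → ℝ),
    IsDAG D' → IsMAGOverObs D' M → IsDensity f' → ConsistentWith D' f' →
    ∀ v : (V ⊕ L) → Ω,
      margOn (obsMargin (doDens D' f' (X.image Sum.inl) v)) Y (fun i => v (Sum.inl i)) =
        if Z = ∅ then condOn (obsMargin f') Y X (fun i => v (Sum.inl i))
        else ∑ w : ({i // i ∈ Z} → Ω),
          condOn (obsMargin f') Y (X ∪ Z) (patch Z (fun i => v (Sum.inl i)) w) *
            margOn (obsMargin f') Z (patch Z (fun i => v (Sum.inl i)) w)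

/-- The distance-from-`Z` of a node `q`: the length of a shortest directed path
(possibly of length 0) from `q` to a member of `Z`. -/
noncomputable def distZ (G : PMG V) (Z : Finset V) (q : V) : ℕ :=
  sInf { n | ∃ p, IsPath G p ∧ DirectedAlong G p ∧ p.head? = some q ∧
      (∃ z ∈ Z, p.getLast? = some z) ∧ p.length = n + 1 }

/-- The distance-from-`Z` of a path `p`: the sum of the distances-from-`Z`
of the colliders on `p`. -/
noncomputable def pathDistZ (G : PMG V) (Z : Finset V) (p : List V) : ℕ :=
  ∑ i ∈ Finset.range p.length,
    if ColliderAt G p i then (p[i+1]?.elim 0 (distZ G Z)) else 0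

end PMG

namespace PMG
section Helpers
variable {V : Type}

/-- arrowhead at `b` on the edge between `a` and `b`. -/
abbrev Arr (G : PMG V) (a b : V) : Prop := G.mark a b = some Mark.arrow

/-- list of the values of `f` at `0,…,n`. -/
def Lf (f : ℕ → V) (n : ℕ) : List V := (List.range (n+1)).map f

theorem Lf_get (f : ℕ → V) (n i : ℕ) : (Lf f n)[i]? = if i ≤ n then some (f i) else none := by
  unfold Lf
  rw [List.getElem?_map]
  split_ifs with h
  · rw [List.getElem?_range (by omega)]; rfl
  · rw [List.getElem?_eq_none (by simp; omega)]; rfl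

theorem Lf_get_some {f : ℕ → V} {n i : ℕ} {a : V} :
    (Lf f n)[i]? = some a ↔ i ≤ n ∧ f i = a := by
  rw [Lf_get]; split_ifs with h <;> simp [h]

@[simp] theorem Lf_length (f : ℕ → V) (n : ℕ) : (Lf f n).length = n + 1 := by simp [Lf]

theorem Lf_ne_nil (f : ℕ → V) (n : ℕ) : Lf f n ≠ [] := by
  intro h
  have := Lf_length f n
  rw [h] at this
  simp at this

theorem Lf_head (f : ℕ → V) (n : ℕ) : (Lf f n).head? = some (f 0) := by
  rw [List.head?_eq_getElem?, Lf_get]; simp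

theorem Lf_last (f : ℕ → V) (n : ℕ) : (Lf f n).getLast? = some (f n) := by
  rw [List.getLast?_eq_getElem?, Lf_get]; simp

theorem Lf_mem {f : ℕ → V} {n : ℕ} {a : V} : a ∈ Lf f n ↔ ∃ i, i ≤ n ∧ f i = a := by
  simp [Lf]

theorem Lf_mem_tail {f : ℕ → V} {n : ℕ} {a : V} :
    a ∈ (Lf f n).tail ↔ ∃ i, 1 ≤ i ∧ i ≤ n ∧ f i = a := by
  rw [List.mem_iff_getElem?]
  constructor
  · rintro ⟨i, hi⟩
    rw [List.getElem?_tail, Lf_get_some] at hi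
    exact ⟨i+1, by omega, hi.1, hi.2⟩
  · rintro ⟨i, h1, h2, h3⟩
    refine ⟨i-1, ?_⟩
    rw [List.getElem?_tail, Lf_get_some]
    have : i - 1 + 1 = i := by omega
    rw [this]; exact ⟨h2, h3⟩

theorem exists_Lf (p : List V) (h : p ≠ []) : ∃ f n, p = Lf f n := by
  refine ⟨fun i => p[i]?.getD (p.head h), p.length - 1, ?_⟩
  have hl : 0 < p.length := List.length_pos_iff.2 h
  apply List.ext_getElem?
  intro i
  rw [Lf_get]
  split_ifs with hi
  · rw [List.getElem?_eq_getElem (by omega)]; simp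
  · exact List.getElem?_eq_none (by omega)

theorem Lf_isPath {G : PMG V} {f : ℕ → V} {n : ℕ} :
    IsPath G (Lf f n) ↔ (∀ i, i < n → G.Adj (f i) (f (i+1))) ∧
      (∀ i j, i ≤ n → j ≤ n → f i = f j → i = j) := by
  unfold IsPath
  constructor
  · rintro ⟨-, h2, h3⟩
    constructor
    · intro i hi
      have := List.isChain_iff_getElem.1 h3 i (by simp; omega)
      simpa [Lf] using this
    · intro i j hi hj hij
      have := List.Nodup.getElem_inj_iff h2 (i := i) (j := j) (hi := by simp; omega) (hj := by simp; omega)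
      apply this.1
      simpa [Lf] using hij
  · rintro ⟨h1, h2⟩
    refine ⟨Lf_ne_nil _ _, ?_, ?_⟩
    · unfold Lf
      apply List.Nodup.map_on _ List.nodup_range
      intro x hx y hy hxy
      rw [List.mem_range] at hx hy
      exact h2 x y (by omega) (by omega) hxy
    · apply List.isChain_iff_getElem.2
      intro i hi
      have := h1 i (by simp at hi; omega)
      simpa [Lf] using this

theorem Lf_proper {G : PMG V} {X Y : Finset V} {f : ℕ → V} {n : ℕ} :
    ProperPath G X Y (Lf f n) ↔ ((∀ i, i < n → G.Adj (f i) (f (i+1))) ∧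
      (∀ i j, i ≤ n → j ≤ n → f i = f j → i = j)) ∧ f 0 ∈ X ∧ f n ∈ Y ∧
      ∀ i, 1 ≤ i → i ≤ n → f i ∉ X := by
  unfold ProperPath
  rw [Lf_isPath, Lf_head, Lf_last]
  simp only [Option.some.injEq, exists_eq_right']
  constructor
  · rintro ⟨h1, h2, h3, h4⟩
    exact ⟨h1, h2, h3, fun i h h' => h4 _ (Lf_mem_tail.2 ⟨i, h, h', rfl⟩)⟩
  · rintro ⟨h1, h2, h3, h4⟩
    refine ⟨h1, h2, h3, fun c hc => ?_⟩
    obtain ⟨i, h, h', rfl⟩ := Lf_mem_tail.1 hc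
    exact h4 i h h'

theorem Lf_possDir {G : PMG V} {f : ℕ → V} {n : ℕ} :
    PossDirAlong G (Lf f n) ↔ ∀ i, i < n → ¬ G.Arr (f (i+1)) (f i) := by
  unfold PossDirAlong
  simp only [Lf_get_some]
  constructor
  · intro h i hi
    exact h i _ _ ⟨by omega, rfl⟩ ⟨by omega, rfl⟩
  · rintro h i a b ⟨h1, rfl⟩ ⟨h2, rfl⟩
    exact h i (by omega)

theorem Lf_dir {G : PMG V} {f : ℕ → V} {n : ℕ} :
    DirectedAlong G (Lf f n) ↔ ∀ i, i < n → G.DirEdge (f i) (f (i+1)) := by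
  unfold DirectedAlong
  simp only [Lf_get_some]
  constructor
  · intro h i hi
    exact h i _ _ ⟨by omega, rfl⟩ ⟨by omega, rfl⟩
  · rintro h i a b ⟨h1, rfl⟩ ⟨h2, rfl⟩
    exact h i (by omega)

theorem Lf_coll {G : PMG V} {f : ℕ → V} {n i : ℕ} :
    ColliderAt G (Lf f n) i ↔ i + 2 ≤ n ∧ G.Arr (f i) (f (i+1)) ∧ G.Arr (f (i+2)) (f (i+1)) := by
  unfold ColliderAt
  simp only [Lf_get_some]
  constructor
  · rintro ⟨a, b, c, ⟨h1, rfl⟩, ⟨h2, rfl⟩, ⟨h3, rfl⟩, h4, h5⟩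
    exact ⟨h3, h4, h5⟩
  · rintro ⟨h1, h2, h3⟩
    exact ⟨_, _, _, ⟨by omega, rfl⟩, ⟨by omega, rfl⟩, ⟨by omega, rfl⟩, h2, h3⟩

theorem Lf_dnc {G : PMG V} {f : ℕ → V} {n i : ℕ} :
    DefNonColliderAt G (Lf f n) i ↔ i + 2 ≤ n ∧
    (G.mark (f i) (f (i+1)) = some Mark.tail ∨ G.mark (f (i+2)) (f (i+1)) = some Mark.tail ∨
      (G.mark (f i) (f (i+1)) = some Mark.circle ∧ G.mark (f (i+2)) (f (i+1)) = some Mark.circle ∧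
        ¬ G.Adj (f i) (f (i+2)))) := by
  unfold DefNonColliderAt
  simp only [Lf_get_some]
  constructor
  · rintro ⟨a, b, c, ⟨h1, rfl⟩, ⟨h2, rfl⟩, ⟨h3, rfl⟩, h4⟩
    exact ⟨h3, h4⟩
  · rintro ⟨h1, h2⟩
    exact ⟨_, _, _, ⟨by omega, rfl⟩, ⟨by omega, rfl⟩, ⟨by omega, rfl⟩, h2⟩

theorem adj_symm {G : PMG V} {a b : V} (h : G.Adj a b) : G.Adj b a := (G.symm a b).1 h

theorem adj_ne {G : PMG V} {a b : V} (h : G.Adj a b) : a ≠ b := by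
  rintro rfl
  simp [Adj, G.irrefl] at h

theorem Arr.adj {G : PMG V} {a b : V} (h : G.Arr a b) : G.Adj a b := by
  simp [Adj, h]

theorem DirEdge.adj {G : PMG V} {a b : V} (h : G.DirEdge a b) : G.Adj a b := by
  simp [Adj, h.1]

theorem DirEdge.not_arr {G : PMG V} {a b : V} (h : G.DirEdge a b) : ¬ G.Arr b a := by
  intro h'
  have := h.2
  rw [h'] at this
  simp at this

open Relation

/-- existence of function-indexed directed paths -/
theorem rtg_iff_fun {R : V → V → Prop} {a b : V} :
    ReflTransGen R a b ↔ ∃ (g : ℕ → V) (k : ℕ), g 0 = a ∧ g k = b ∧ ∀ i, i < k → R (g i) (g (i+1)) := by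
  constructor
  · intro h
    induction h with
    | refl => exact ⟨fun _ => a, 0, rfl, rfl, fun i hi => by omega⟩
    | @tail b c _ hbc ih =>
      obtain ⟨g, k, h0, hk, hg⟩ := ih
      refine ⟨fun i => if i ≤ k then g i else c, k+1, by simpa using h0, by simp, ?_⟩
      intro i hi
      by_cases h : i < k
      · have h1 : i ≤ k := by omega
        have h2 : i + 1 ≤ k := by omega
        simp only [h1, h2, if_true]; exact hg i h
      · obtain rfl : i = k := by omega
        simp [hk, hbc]
  · rintro ⟨g, k, rfl, rfl, hg⟩
    have : ∀ j, j ≤ k → ReflTransGen R (g 0) (g j) := by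
      intro j
      induction j with
      | zero => intro _; exact .refl
      | succ j ih => intro hj; exact (ih (by omega)).tail (hg j (by omega))
    exact this k le_rfl

/-- loop erasure -/
theorem rtg_exists_inj {R : V → V → Prop} {a b : V} (h : ReflTransGen R a b) :
    ∃ (g : ℕ → V) (k : ℕ), g 0 = a ∧ g k = b ∧ (∀ i, i < k → R (g i) (g (i+1))) ∧
      ∀ i j, i ≤ k → j ≤ k → g i = g j → i = j := by
  induction h with
  | refl => exact ⟨fun _ => a, 0, rfl, rfl, fun i hi => by omega, fun i j hi hj _ => by omega⟩
  | @tail b c _ hbc ih =>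
    obtain ⟨g, k, h0, hk, hg, hinj⟩ := ih
    by_cases hc : ∃ i, i ≤ k ∧ g i = c
    · obtain ⟨i, hi, hic⟩ := hc
      exact ⟨g, i, h0, hic, fun j hj => hg j (by omega), fun x y hx hy => hinj x y (by omega) (by omega)⟩
    · push Not at hc
      refine ⟨fun i => if i ≤ k then g i else c, k+1, by simpa using h0, by simp, ?_, ?_⟩
      · intro i hi
        by_cases h : i < k
        · have h1 : i ≤ k := by omega
          have h2 : i + 1 ≤ k := by omega
          simp only [h1, h2, if_true]; exact hg i h
        · obtain rfl : i = k := by omega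
          simp [hk, hbc]
      · intro i j hi hj hij
        by_cases h1 : i ≤ k <;> by_cases h2 : j ≤ k
        · simp only [h1, h2, if_true] at hij; exact hinj i j h1 h2 hij
        · simp only [h1, h2, if_true, if_false] at hij; exact absurd hij (hc i h1)
        · simp only [h1, h2, if_true, if_false] at hij; exact absurd hij.symm (hc j h2)
        · omega

theorem desc_iff {G : PMG V} {a b : V} : Descendant G a b ↔ ReflTransGen G.DirEdge a b := by
  constructor
  · rintro ⟨p, hp, hd, hh, hl⟩
    obtain ⟨f, n, rfl⟩ := exists_Lf p hp.1
    rw [Lf_head] at hh; rw [Lf_last] at hl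
    simp only [Option.some.injEq] at hh hl
    exact rtg_iff_fun.2 ⟨f, n, hh, hl, Lf_dir.1 hd⟩
  · intro h
    obtain ⟨g, k, h0, hk, hg, hinj⟩ := rtg_exists_inj h
    refine ⟨Lf g k, Lf_isPath.2 ⟨fun i hi => (hg i hi).adj, hinj⟩, Lf_dir.2 hg, ?_, ?_⟩
    · rw [Lf_head, h0]
    · rw [Lf_last, hk]

theorem not_arr_dir {M : PMG V} (hM : IsAncestral M) {a b : V} (h : M.Adj a b)
    (h' : ¬ M.Arr a b) : M.DirEdge b a := by
  rcases hM.1 a b h with h1 | h1 | h1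
  · exact absurd h1.1 h'
  · exact h1
  · exact absurd h1.1 h'

theorem tail_dir {M : PMG V} (hM : IsAncestral M) {a b : V} (h : M.mark a b = some Mark.tail) :
    M.DirEdge b a := by
  apply not_arr_dir hM
  · simp [Adj, h]
  · simp [Arr, h]

theorem anc_cyc {M : PMG V} (hM : IsAncestral M) {x y : V} (h : M.Arr x y)
    (h' : ReflTransGen M.DirEdge y x) : False := by
  rcases hM.1 x y h.adj with h1 | h1 | h1
  · have := hM.2.1 x y (desc_iff.2 (.single h1)) (desc_iff.2 h')
    exact adj_ne h.adj this
  · exact h1.not_arr h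
  · exact hM.2.2 y x (desc_iff.2 h') h1

theorem cyc1 {M : PMG V} (hM : IsAncestral M) {x y u : V} (h : M.Arr x y)
    (h1 : M.DirEdge y u) (h2 : M.DirEdge u x) : False :=
  anc_cyc hM h ((ReflTransGen.single h1).tail h2)

/-- `a *→ b → s` and `a`, `s` adjacent gives `a *→ s`. -/
theorem arr_trans {M : PMG V} (hM : IsAncestral M) {a b s : V} (h : M.Arr a b)
    (h1 : M.DirEdge b s) (h2 : M.Adj a s) : M.Arr a s := by
  by_contra h3
  exact cyc1 hM h h1 (not_arr_dir hM h2 h3)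

theorem dir_dir_adj {M : PMG V} (hM : IsAncestral M) {a b s : V} (h : M.DirEdge a b)
    (h1 : M.DirEdge b s) (h2 : M.Adj a s) : M.DirEdge a s := by
  apply not_arr_dir hM (adj_symm h2)
  intro h3
  exact cyc1 hM h3 h h1

/-- `b` has a descendant in `Z` -/
def An (M : PMG V) (Z : Finset V) (b : V) : Prop := ∃ z ∈ Z, Descendant M b z

theorem An.of_mem {M : PMG V} {Z : Finset V} {b : V} (h : b ∈ Z) : An M Z b :=
  ⟨b, h, desc_iff.2 .refl⟩

theorem An.of_dir {M : PMG V} {Z : Finset V} {a b : V} (h : M.DirEdge a b) (h' : An M Z b) :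
    An M Z a := by
  obtain ⟨z, hz, hd⟩ := h'
  exact ⟨z, hz, desc_iff.2 (ReflTransGen.head h (desc_iff.1 hd))⟩

/-- triple `a,b,c` is open at `b` given `Z` -/
def Ok (M : PMG V) (Z : Finset V) (a b c : V) : Prop :=
  (M.Arr a b → M.Arr c b → An M Z b) ∧ (¬ (M.Arr a b ∧ M.Arr c b) → b ∉ Z)

structure Conn (M : PMG V) (Z : Finset V) (f : ℕ → V) (n : ℕ) : Prop where
  adj : ∀ i, i < n → M.Adj (f i) (f (i+1))
  inj : ∀ i j, i ≤ n → j ≤ n → f i = f j → i = j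
  ok : ∀ i, i + 2 ≤ n → Ok M Z (f i) (f (i+1)) (f (i+2))

theorem Lf_mconn {M : PMG V} (hM : IsAncestral M) {Z : Finset V} {f : ℕ → V} {n : ℕ}
    (hadj : ∀ i, i < n → M.Adj (f i) (f (i+1))) :
    MConn M Z (Lf f n) ↔ ∀ i, i + 2 ≤ n → Ok M Z (f i) (f (i+1)) (f (i+2)) := by
  have key : ∀ i, i + 2 ≤ n → ¬ (M.Arr (f i) (f (i+1)) ∧ M.Arr (f (i+2)) (f (i+1))) →
      DefNonColliderAt M (Lf f n) i := by
    intro i hi h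
    rw [Lf_dnc]
    refine ⟨hi, ?_⟩
    by_cases h1 : M.Arr (f i) (f (i+1))
    · right; left
      have h2 : ¬ M.Arr (f (i+2)) (f (i+1)) := fun h2 => h ⟨h1, h2⟩
      exact (not_arr_dir hM (adj_symm (hadj (i+1) (by omega))) h2).2
    · left
      exact (not_arr_dir hM (hadj i (by omega)) h1).2
  constructor
  · rintro ⟨h1, h2, h3⟩ i hi
    constructor
    · intro ha hb
      exact h3 i _ (Lf_get_some.2 ⟨by omega, rfl⟩) (Lf_coll.2 ⟨hi, ha, hb⟩)
    · intro h
      exact h2 i _ (Lf_get_some.2 ⟨by omega, rfl⟩) (key i hi h)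
  · intro h
    refine ⟨?_, ?_, ?_⟩
    · intro i hi
      rw [Lf_length] at hi
      by_cases hc : M.Arr (f i) (f (i+1)) ∧ M.Arr (f (i+2)) (f (i+1))
      · left; exact Lf_coll.2 ⟨by omega, hc⟩
      · right; exact key i (by omega) hc
    · intro i b hb hd
      obtain ⟨hi, rfl⟩ := Lf_get_some.1 hb
      obtain ⟨hi2, hd⟩ := Lf_dnc.1 hd
      apply (h i hi2).2
      rintro ⟨h1, h2⟩
      rw [h1, h2] at hd
      simp at hd
    · intro i b hb hd
      obtain ⟨hi, rfl⟩ := Lf_get_some.1 hb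
      obtain ⟨hi2, hd⟩ := Lf_coll.1 hd
      exact (h i hi2).1 hd.1 hd.2

theorem Conn.not_msep {M : PMG V} (hM : IsAncestral M) {Z : Finset V} {f : ℕ → V} {n : ℕ}
    (h : Conn M Z f n) (hn : 1 ≤ n) : ¬ MSep M (f 0) (f n) Z := by
  intro hs
  refine hs (Lf f n) ⟨Lf_isPath.2 ⟨h.adj, h.inj⟩, Lf_head _ _, Lf_last _ _, by simp; omega⟩ ?_
  exact (Lf_mconn hM h.adj).2 h.ok

theorem Conn.single {M : PMG V} {Z : Finset V} (s : V) : Conn M Z (fun _ => s) 0 :=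
  ⟨fun i hi => by omega, fun i j hi hj _ => by omega, fun i hi => by omega⟩

theorem Conn.initSeg {M : PMG V} {Z : Finset V} {f : ℕ → V} {n : ℕ} (h : Conn M Z f n) {l : ℕ}
    (hl : l ≤ n) : Conn M Z f l :=
  ⟨fun i hi => h.adj i (by omega), fun i j hi hj => h.inj i j (by omega) (by omega),
    fun i hi => h.ok i (by omega)⟩

theorem Conn.suffix {M : PMG V} {Z : Finset V} {f : ℕ → V} {n : ℕ} (h : Conn M Z f n) {r : ℕ}
    (hr : r ≤ n) : Conn M Z (fun t => f (r + t)) (n - r) :=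
  ⟨fun i hi => h.adj (r+i) (by omega), fun i j hi hj hij => by
    have := h.inj _ _ (by omega) (by omega) hij
    omega,
    fun i hi => h.ok (r+i) (by omega)⟩

/-- concatenation function -/
def cat (f : ℕ → V) (l : ℕ) (g : ℕ → V) : ℕ → V := fun t => if t ≤ l then f t else g (t - (l+1))

theorem cat_le {f g : ℕ → V} {l t : ℕ} (h : t ≤ l) : cat f l g t = f t := by simp [cat, h]
theorem cat_add (f g : ℕ → V) (l t : ℕ) : cat f l g (l + 1 + t) = g t := by
  have h : ¬ (l + 1 + t ≤ l) := by omega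
  simp only [cat, h, if_false]
  congr 1; omega
theorem cat_ge {f g : ℕ → V} {l t : ℕ} (h : l < t) : cat f l g t = g (t - (l+1)) := by
  have h : ¬ (t ≤ l) := by omega
  simp only [cat, h, if_false]

theorem Conn.cat {M : PMG V} {Z : Finset V} {f g : ℕ → V} {l k : ℕ} (hf : Conn M Z f l)
    (hg : Conn M Z g k) (hb : M.Adj (f l) (g 0))
    (hd : ∀ i j, i ≤ l → j ≤ k → f i ≠ g j)
    (h1 : ∀ i, i + 1 = l → Ok M Z (f i) (f l) (g 0))
    (h2 : 1 ≤ k → Ok M Z (f l) (g 0) (g 1)) : Conn M Z (PMG.cat f l g) (l + 1 + k) := by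
  refine ⟨?_, ?_, ?_⟩
  · intro i hi
    rcases lt_trichotomy i l with h | h | h
    · rw [cat_le (by omega), cat_le (by omega)]; exact hf.adj i h
    · subst h
      rw [cat_le le_rfl, show i + 1 = i + 1 + 0 from rfl, cat_add]; exact hb
    · rw [cat_ge h, cat_ge (by omega), show i + 1 - (l+1) = i - (l+1) + 1 by omega]
      exact hg.adj _ (by omega)
  · intro i j hi hj hij
    by_cases hil : i ≤ l <;> by_cases hjl : j ≤ l
    · rw [cat_le hil, cat_le hjl] at hij; exact hf.inj i j hil hjl hij
    · rw [cat_le hil, cat_ge (by omega)] at hij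
      exact absurd hij (hd _ _ hil (by omega))
    · rw [cat_le hjl, cat_ge (by omega)] at hij
      exact absurd hij.symm (hd _ _ hjl (by omega))
    · rw [cat_ge (by omega), cat_ge (by omega)] at hij
      have := hg.inj _ _ (by omega) (by omega) hij
      omega
  · intro i hi
    by_cases c1 : i + 2 ≤ l
    · rw [cat_le (by omega), cat_le (by omega), cat_le (by omega)]; exact hf.ok i c1
    · by_cases c2 : i + 1 = l
      · subst c2
        rw [cat_le (by omega), cat_le (by omega), show i + 2 = i + 1 + 1 + 0 from rfl, cat_add]
        exact h1 i rfl
      · by_cases c3 : i = l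
        · subst c3
          rw [cat_le (by omega), show i + 1 = i + 1 + 0 from rfl, cat_add,
            show i + 2 = i + 1 + 1 from rfl, cat_add]
          exact h2 (by omega)
        · rw [cat_ge (by omega), cat_ge (by omega), cat_ge (by omega),
            show i + 1 - (l+1) = i - (l+1) + 1 by omega, show i + 2 - (l+1) = i - (l+1) + 2 by omega]
          exact hg.ok _ (by omega)


/-- `u` is reached from `w` by a collider walk into `u` with inner nodes in `S`. -/
inductive Into (N : PMG V) (S : Finset V) (w : V) : V → Prop
  | base {u : V} : N.Arr w u → Into N S w u
  | step {u x : V} : Into N S w u → u ∈ S → N.Arr u x → N.Arr x u → x ≠ w → Into N S w x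

/-- separation data for a non-adjacent pair. -/
structure Sep (N : PMG V) (w c : V) (S : Finset V) : Prop where
  anc : IsAncestral N
  sep : MSep N w c S
  wS : w ∉ S
  cS : c ∉ S
  ne : w ≠ c
  nadj : ¬ N.Adj w c

theorem Into.path {N : PMG V} {S : Finset V} {w u : V} (h : Into N S w u) :
    ∃ (g : ℕ → V) (m : ℕ), g 0 = w ∧ g (m+1) = u ∧
      (∀ i j, i ≤ m+1 → j ≤ m+1 → g i = g j → i = j) ∧
      (∀ i, i < m+1 → N.Arr (g i) (g (i+1))) ∧
      (∀ i, i < m → N.Arr (g (i+2)) (g (i+1)) ∧ g (i+1) ∈ S) := by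
  induction h with
  | @base u h =>
    have hne : w ≠ u := adj_ne h.adj
    refine ⟨fun i => if i = 0 then w else u, 0, by simp, by simp, ?_, ?_, ?_⟩
    · intro i j hi hj hij
      by_cases h1 : i = 0 <;> by_cases h2 : j = 0
      · omega
      · simp [h1, h2] at hij; exact absurd hij hne
      · simp [h1, h2] at hij; exact absurd hij.symm hne
      · omega
    · intro i hi
      obtain rfl : i = 0 := by omega
      simpa using h
    · intro i hi; omega
  | @step u x hu huS hux hxu hxw ih =>
    obtain ⟨g, m, h0, hm, hinj, ha, hb⟩ := ih
    by_cases hc : ∃ i, i ≤ m+1 ∧ g i = x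
    · obtain ⟨i, hi, hix⟩ := hc
      obtain ⟨k, rfl⟩ : ∃ k, i = k + 1 := by
        cases i with
        | zero => exact absurd (hix.symm.trans h0) hxw
        | succ k => exact ⟨k, rfl⟩
      exact ⟨g, k, h0, hix, fun a b ha hb => hinj a b (by omega) (by omega),
        fun a h => ha a (by omega), fun a h => hb a (by omega)⟩
    · push Not at hc
      refine ⟨cat g (m+1) (fun _ => x), m+1, by rw [cat_le (by omega), h0], by rw [cat_ge (by omega)], ?_, ?_, ?_⟩
      · intro i j hi hj hij
        by_cases hil : i ≤ m+1 <;> by_cases hjl : j ≤ m+1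
        · rw [cat_le hil, cat_le hjl] at hij; exact hinj i j hil hjl hij
        · rw [cat_le hil, cat_ge (by omega)] at hij
          exact absurd hij (hc _ hil)
        · rw [cat_le hjl, cat_ge (by omega)] at hij
          exact absurd hij.symm (hc _ hjl)
        · omega
      · intro i hi
        by_cases h : i < m+1
        · rw [cat_le (by omega), cat_le (by omega)]; exact ha i h
        · obtain rfl : i = m+1 := by omega
          rw [cat_le (by omega), cat_ge (by omega), hm]; exact hux
      · intro i hi
        by_cases h : i < m
        · rw [cat_le (by omega), cat_le (by omega)]; exact hb i h
        · obtain rfl : i = m := by omega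
          rw [cat_ge (by omega), cat_le (by omega), hm]; exact ⟨hxu, huS⟩

/-- packaged version: `Conn` path to `u`, with arrow into `u`. -/
theorem Into.conn {N : PMG V} {S : Finset V} {w u : V} (h : Into N S w u) :
    ∃ (g : ℕ → V) (m : ℕ), g 0 = w ∧ g (m+1) = u ∧ Conn N S g (m+1) ∧ N.Arr (g m) u ∧
      (∀ i, 1 ≤ i → i ≤ m → g i ∈ S) := by
  obtain ⟨g, m, h0, hm, hinj, ha, hb⟩ := h.path
  refine ⟨g, m, h0, hm, ⟨fun i hi => (ha i hi).adj, hinj, ?_⟩, ?_, ?_⟩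
  · intro i hi
    refine ⟨fun _ _ => An.of_mem (hb i (by omega)).2, fun hn => absurd ⟨ha i (by omega), (hb i (by omega)).1⟩ hn⟩
  · rw [← hm]; exact ha m (by omega)
  · intro i h1 h2
    have := (hb (i-1) (by omega)).2
    rwa [show i - 1 + 1 = i by omega] at this

/-- the extended path to `c` must be blocked at `u`. -/
theorem Sep.blocked {N : PMG V} {w c u : V} {S : Finset V} (hs : Sep N w c S)
    (hu : Into N S w u) (hadj : N.Adj u c) : (u ∈ S ↔ N.DirEdge u c) := by
  obtain ⟨g, m, h0, hm, hconn, harr, hS⟩ := hu.conn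
  have key : (N.Arr c u → An N S u) → (¬ N.Arr c u → u ∉ S) → False := by
    intro k1 k2
    have hc := Conn.cat hconn (Conn.single c) (by rw [hm]; exact hadj) ?_ ?_ (by omega)
    · have := hc.not_msep hs.anc (by omega)
      rw [cat_le (by omega), h0, cat_add] at this
      exact this hs.sep
    · intro i j hi hj
      by_cases hi0 : i = 0
      · rw [hi0, h0]; exact hs.ne
      · by_cases him : i = m+1
        · rw [him, hm]; exact adj_ne hadj
        · intro h
          exact hs.cS (h ▸ hS i (by omega) (by omega))
    · intro i hi
      obtain rfl : i = m := by omega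
      rw [hm]
      exact ⟨fun _ h => k1 h, fun h => k2 (fun h' => h ⟨harr, h'⟩)⟩
  constructor
  · intro huS
    by_contra hd
    refine key (fun _ => An.of_mem huS) (fun h => absurd (not_arr_dir hs.anc (adj_symm hadj) h) hd)
  · intro hd
    by_contra huS
    exact key (fun h => absurd h hd.not_arr) (fun _ => huS)

/-- discriminated node status. -/
theorem Sep.status {N : PMG V} {w c a b : V} {S : Finset V} (hs : Sep N w c S)
    (ha : Into N S w a) (haS : a ∈ S) (hba : N.Arr b a) (hbc : N.Adj b c) (hac : N.Adj a c) :
    (b ∈ S ↔ N.DirEdge b c) ∧ (b ∉ S ↔ (N.Arr a b ∧ N.Arr c b)) := by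
  have hdac : N.DirEdge a c := (hs.blocked ha hac).1 haS
  have hbw : b ≠ w := by rintro rfl; exact hs.nadj hbc
  have h1 : b ∈ S ↔ N.DirEdge b c := by
    by_cases hab : N.Arr a b
    · exact hs.blocked (ha.step haS hab hba hbw) hbc
    · have hdba := not_arr_dir hs.anc (adj_symm hba.adj) hab
      have hdbc := dir_dir_adj hs.anc hdba hdac hbc
      refine ⟨fun _ => hdbc, fun _ => ?_⟩
      by_contra hbS
      obtain ⟨g, m, h0, hm, hconn, harr, hS⟩ := ha.conn
      have hbcne := adj_ne hbc
      have hc2 : Conn N S (PMG.cat (fun _ => b) 0 (fun _ => c)) 1 :=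
        Conn.cat (Conn.single b) (Conn.single c) hbc (fun _ _ _ _ => hbcne) (by omega) (by omega)
      have hc := Conn.cat hconn hc2 (by rw [hm, cat_le le_rfl]; exact adj_symm hba.adj) ?_ ?_ ?_
      · have := hc.not_msep hs.anc (by omega)
        rw [cat_le (by omega), h0, cat_add, cat_ge (by omega)] at this
        exact this hs.sep
      · intro i j hi hj
        have hib : g i ≠ b ∧ g i ≠ c := by
          by_cases hi0 : i = 0
          · rw [hi0, h0]; exact ⟨hbw.symm, hs.ne⟩
          · by_cases him : i = m+1
            · rw [him, hm]; exact ⟨(adj_ne hba.adj).symm, adj_ne hac⟩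
            · have := hS i (by omega) (by omega)
              exact ⟨fun h => hbS (h ▸ this), fun h => hs.cS (h ▸ this)⟩
        by_cases hj0 : j = 0
        · rw [cat_le (by omega)]; exact hib.1
        · rw [cat_ge (by omega)]; exact hib.2
      · intro i hi
        obtain rfl : i = m := by omega
        rw [hm, cat_le le_rfl]
        exact ⟨fun _ _ => An.of_mem haS, fun h => absurd ⟨harr, hba⟩ h⟩
      · intro _
        rw [hm, cat_le le_rfl, cat_ge (by omega)]
        exact ⟨fun h _ => absurd h hab, fun _ => hbS⟩
  refine ⟨h1, ?_⟩
  constructor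
  · intro hbS
    have hcb : N.Arr c b := by
      by_contra h
      exact hbS (h1.2 (not_arr_dir hs.anc (adj_symm hbc) h))
    refine ⟨?_, hcb⟩
    by_contra hab
    exact cyc1 hs.anc hcb (not_arr_dir hs.anc (adj_symm hba.adj) hab) hdac
  · rintro ⟨_, hcb⟩ hbS
    exact (h1.1 hbS).not_arr hcb

/-- unshielded triple status. -/
theorem Sep.unsh {N : PMG V} {w c b : V} {S : Finset V} (hs : Sep N w c S)
    (hwb : N.Adj w b) (hbc : N.Adj b c) : (b ∉ S ↔ (N.Arr w b ∧ N.Arr c b)) := by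
  by_cases hab : N.Arr w b
  · have := hs.blocked (.base hab) hbc
    rw [this]
    constructor
    · intro h
      refine ⟨hab, ?_⟩
      by_contra hcb
      exact h (not_arr_dir hs.anc (adj_symm hbc) hcb)
    · rintro ⟨_, h⟩ h2
      exact h2.not_arr h
  · refine ⟨fun hbS => ?_, fun h => absurd h.1 hab⟩
    exfalso
    have hbcne := adj_ne hbc
    have hwbne := adj_ne hwb
    have hc2 : Conn N S (PMG.cat (fun _ => b) 0 (fun _ => c)) 1 :=
      Conn.cat (Conn.single b) (Conn.single c) hbc (fun _ _ _ _ => hbcne) (by omega) (by omega)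
    have hc := Conn.cat (Conn.single w) hc2 (by rw [cat_le le_rfl]; exact hwb) ?_ (by omega) ?_
    · have := hc.not_msep hs.anc (by omega)
      rw [cat_le (by omega), cat_add, cat_ge (by omega)] at this
      exact this hs.sep
    · intro i j hi hj
      by_cases hj0 : j = 0
      · rw [cat_le (by omega)]; exact hwbne
      · rw [cat_ge (by omega)]; exact hs.ne
    · intro _
      rw [cat_le le_rfl, cat_ge (by omega)]
      exact ⟨fun h _ => absurd h hab, fun _ => hbS⟩

/-- propagation along a collider chain of parents of `c`. -/
theorem Sep.chain {M N : PMG V} {w c : V} {S : Finset V} (hs : Sep M w c S) (u : ℕ → V) (m : ℕ)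
    (h0M : Into M S w (u 0)) (h0N : Into N S w (u 0))
    (hd : ∀ t, t ≤ m → M.DirEdge (u t) c)
    (hbM : ∀ t, t < m → M.Arr (u t) (u (t+1)) ∧ M.Arr (u (t+1)) (u t))
    (hbN : ∀ t, t < m → N.Arr (u t) (u (t+1)) ∧ N.Arr (u (t+1)) (u t)) :
    ∀ t, t ≤ m → u t ∈ S ∧ Into M S w (u t) ∧ Into N S w (u t) := by
  have hne : ∀ t, t ≤ m → u t ≠ w := by
    rintro t ht h
    exact hs.nadj (h ▸ (hd t ht).adj)
  intro t
  induction t with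
  | zero => intro _; exact ⟨(hs.blocked h0M (hd 0 (by omega)).adj).2 (hd 0 (by omega)), h0M, h0N⟩
  | succ t ih =>
    intro ht
    obtain ⟨h1, h2, h3⟩ := ih (by omega)
    have h4 := h2.step h1 (hbM t (by omega)).1 (hbM t (by omega)).2 (hne _ ht)
    have h5 := h3.step h1 (hbN t (by omega)).1 (hbN t (by omega)).2 (hne _ ht)
    exact ⟨(hs.blocked h4 (hd _ ht).adj).2 (hd _ ht), h4, h5⟩


/-- The situation of the lemma, in terms of a function-indexed path. -/
structure Ctx (P : PMG V) (cls : Set (PMG V)) (M : PMG V) (X Y Z : Finset V) (v : ℕ → V) (n : ℕ) :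
    Prop where
  hP : IsPAGOf P cls
  hM : M ∈ cls
  hAm : Amenable P (Visible P) X Y
  hZ : ∀ z ∈ Z, z ∉ Forb P X Y
  conn : Conn M Z v n
  v0 : v 0 ∈ X
  vn : v n ∈ Y
  vX : ∀ i, 1 ≤ i → i ≤ n → v i ∉ X
  nc : ∃ i, i < n ∧ M.Arr (v (i+1)) (v i)
  short : ∀ (g : ℕ → V) (m : ℕ), Conn M Z g m → g 0 ∈ X → g m ∈ Y →
    (∀ i, 1 ≤ i → i ≤ m → g i ∉ X) → (∃ i, i < m ∧ M.Arr (g (i+1)) (g i)) → n ≤ m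

section PAG
variable {P : PMG V} {cls : Set (PMG V)} {M N : PMG V}

theorem pag_anc (hP : IsPAGOf P cls) (hN : N ∈ cls) : IsAncestral N := (hP.2.1 N hN).1

theorem pag_adj (hP : IsPAGOf P cls) (hN : N ∈ cls) {a b : V} : P.Adj a b ↔ N.Adj a b :=
  hP.2.2.2.2.1 N hN a b

theorem pag_adj2 (hP : IsPAGOf P cls) (hM : M ∈ cls) (hN : N ∈ cls) {a b : V} :
    M.Adj a b ↔ N.Adj a b := (pag_adj hP hM).symm.trans (pag_adj hP hN)

theorem pag_arr (hP : IsPAGOf P cls) (hN : N ∈ cls) {a b : V} (h : P.Arr a b) : N.Arr a b :=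
  ((hP.2.2.2.2.2.1 a b).1 h).2 N hN

theorem pag_dir (hP : IsPAGOf P cls) (hN : N ∈ cls) {a b : V} (h : P.DirEdge a b) :
    N.DirEdge a b :=
  ⟨pag_arr hP hN h.1, ((hP.2.2.2.2.2.2 b a).1 h.2).2 N hN⟩

theorem pag_arr_of (hP : IsPAGOf P cls) (hM : M ∈ cls) {a b : V}
    (h : ∀ N ∈ cls, N.Arr a b) : P.Arr a b :=
  (hP.2.2.2.2.2.1 a b).2 ⟨(pag_adj hP hM).2 (h M hM).adj, h⟩

theorem pag_dir_of (hP : IsPAGOf P cls) (hM : M ∈ cls) {a b : V}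
    (h : ∀ N ∈ cls, N.DirEdge a b) : P.DirEdge a b :=
  ⟨pag_arr_of hP hM (fun N hN => (h N hN).1),
    (hP.2.2.2.2.2.2 b a).2 ⟨(pag_adj hP hM).2 (adj_symm (h M hM).adj), fun N hN => (h N hN).2⟩⟩

theorem pag_sep (hP : IsPAGOf P cls) (hM : M ∈ cls) {a b : V} (hne : a ≠ b) (h : ¬ M.Adj a b) :
    ∃ S, ∀ N ∈ cls, Sep N a b S := by
  obtain ⟨S, h1, h2, h3⟩ := (hP.2.1 M hM).2 a b hne h
  refine ⟨S, fun N hN => ⟨pag_anc hP hN, ?_, h1, h2, hne, fun h' => h ((pag_adj2 hP hN hM).1 h')⟩⟩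
  exact (hP.2.2.2.1 M hM N hN a b S hne h1 h2).1 h3

theorem pag_not_arr (hP : IsPAGOf P cls) (hM : M ∈ cls) {a b : V} (h : M.DirEdge a b) :
    ¬ P.Arr b a := fun h' => h.not_arr (pag_arr hP hM h')

end PAG

theorem okcmp {M : PMG V} {Z : Finset V} {a b c c' : V} (h : Ok M Z a b c) (h' : ¬ Ok M Z a b c') :
    (M.Arr a b ∧ M.Arr c b ∧ ¬ M.Arr c' b) ∨ (M.Arr a b ∧ ¬ M.Arr c b ∧ M.Arr c' b ∧ ¬ An M Z b) := by
  unfold Ok at *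
  tauto

theorem Ok.symm {M : PMG V} {Z : Finset V} {a b c : V} (h : Ok M Z a b c) : Ok M Z c b a := by
  unfold Ok at *
  tauto

/-- `v i` is a collider on the path `v` in `N`. -/
def Cl (N : PMG V) (v : ℕ → V) (i : ℕ) : Prop := N.Arr (v (i-1)) (v i) ∧ N.Arr (v (i+1)) (v i)

namespace Ctx
variable {P : PMG V} {cls : Set (PMG V)} {M : PMG V} {X Y Z : Finset V} {v : ℕ → V} {n : ℕ}

theorem anc (C : Ctx P cls M X Y Z v n) : IsAncestral M := pag_anc C.hP C.hM

theorem ok' (C : Ctx P cls M X Y Z v n) {i : ℕ} (h1 : 1 ≤ i) (h2 : i < n) :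
    Ok M Z (v (i-1)) (v i) (v (i+1)) := by
  obtain ⟨k, rfl⟩ : ∃ k, i = k + 1 := ⟨i-1, by omega⟩
  exact C.conn.ok k (by omega)

theorem adj' (C : Ctx P cls M X Y Z v n) {i : ℕ} (h1 : 1 ≤ i) (h2 : i ≤ n) :
    M.Adj (v (i-1)) (v i) := by
  obtain ⟨k, rfl⟩ : ∃ k, i = k + 1 := ⟨i-1, by omega⟩
  exact C.conn.adj k (by omega)

theorem cl_an (C : Ctx P cls M X Y Z v n) {i : ℕ} (h1 : 1 ≤ i) (h2 : i < n) (h : Cl M v i) :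
    An M Z (v i) := (C.ok' h1 h2).1 h.1 h.2

/-- Possibly directed proper paths in `P` consist of nodes that are not ancestors of `Z`. -/
theorem forb (C : Ctx P cls M X Y Z v n) (f : ℕ → V) (m : ℕ)
    (hadj : ∀ i, i < m → M.Adj (f i) (f (i+1)))
    (hinj : ∀ i j, i ≤ m → j ≤ m → f i = f j → i = j)
    (h0 : f 0 ∈ X) (hm : f m ∈ Y) (hX : ∀ i, 1 ≤ i → i ≤ m → f i ∉ X)
    (hd : ∀ i, i < m → ¬ P.Arr (f (i+1)) (f i)) :
    (∀ t, 1 ≤ t → t ≤ m → ¬ An M Z (f t)) ∧ Visible P (f 0) (f 1) := by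
  have hp : ProperPath P X Y (Lf f m) :=
    Lf_proper.2 ⟨⟨fun i hi => (pag_adj C.hP C.hM).2 (hadj i hi), hinj⟩, h0, hm, hX⟩
  have hpd : PossDirAlong P (Lf f m) := Lf_possDir.2 hd
  constructor
  · rintro t ht1 ht2 ⟨z, hz, hdz⟩
    refine C.hZ z hz ⟨f t, hX t ht1 ht2, ⟨_, hp, hpd, Lf_mem.2 ⟨t, ht2, rfl⟩⟩, ?_⟩
    obtain ⟨q, hq, hqd, hqh, hql⟩ := hdz
    refine ⟨q, ⟨hq.1, hq.2.1, ?_⟩, ?_, hqh, hql⟩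
    · exact List.IsChain.imp (fun a b h => (pag_adj C.hP C.hM).2 h) hq.2.2
    · intro i a b ha hb
      exact pag_not_arr C.hP C.hM (hqd i a b ha hb)
  · obtain ⟨a, b, ha, hb, hv⟩ := C.hAm _ hp hpd
    obtain ⟨_, rfl⟩ := Lf_get_some.1 ha
    obtain ⟨_, rfl⟩ := Lf_get_some.1 hb
    exact hv

theorem pforb (C : Ctx P cls M X Y Z v n) {l r : ℕ} (hlr : l < r) (hr : r ≤ n)
    (hadj : M.Adj (v l) (v r)) (h1 : ∀ t, t < l → ¬ P.Arr (v (t+1)) (v t))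
    (h2 : ¬ P.Arr (v r) (v l)) (h3 : ∀ t, r ≤ t → t < n → ¬ P.Arr (v (t+1)) (v t)) :
    (∀ t, 1 ≤ t → t ≤ l → ¬ An M Z (v t)) ∧ (∀ t, r ≤ t → t ≤ n → ¬ An M Z (v t)) ∧
    (l = 0 → Visible P (v 0) (v r)) := by
  have hf := C.forb (PMG.cat v l (fun t => v (r + t))) (l + 1 + (n - r)) ?_ ?_ ?_ ?_ ?_ ?_
  · refine ⟨fun t ht1 ht2 => ?_, fun t ht1 ht2 => ?_, fun hl => ?_⟩
    · have := hf.1 t ht1 (by omega)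
      rwa [cat_le ht2] at this
    · have := hf.1 (l + 1 + (t - r)) (by omega) (by omega)
      rwa [cat_add, show r + (t - r) = t by omega] at this
    · subst hl
      have := hf.2
      rwa [cat_le le_rfl, cat_ge (by omega)] at this
  · intro i hi
    rcases lt_trichotomy i l with h | h | h
    · rw [cat_le (by omega), cat_le (by omega)]; exact C.conn.adj i (by omega)
    · subst h
      rw [cat_le le_rfl, cat_ge (by omega), show i + 1 - (i + 1) = 0 by omega]; exact hadj
    · rw [cat_ge h, cat_ge (by omega), show r + (i + 1 - (l+1)) = r + (i - (l+1)) + 1 by omega]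
      exact C.conn.adj _ (by omega)
  · intro i j hi hj hij
    by_cases hil : i ≤ l <;> by_cases hjl : j ≤ l
    · rw [cat_le hil, cat_le hjl] at hij; exact C.conn.inj i j (by omega) (by omega) hij
    · rw [cat_le hil, cat_ge (by omega)] at hij
      have := C.conn.inj _ _ (by omega) (by omega) hij
      omega
    · rw [cat_le hjl, cat_ge (by omega)] at hij
      have := C.conn.inj _ _ (by omega) (by omega) hij
      omega
    · rw [cat_ge (by omega), cat_ge (by omega)] at hij
      have := C.conn.inj _ _ (by omega) (by omega) hij
      omega
  · rw [cat_le (by omega)]; exact C.v0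
  · rw [cat_add, show r + (n - r) = n by omega]; exact C.vn
  · intro i hi1 hi2
    by_cases hil : i ≤ l
    · rw [cat_le hil]; exact C.vX i hi1 (by omega)
    · rw [cat_ge (by omega)]; exact C.vX _ (by omega) (by omega)
  · intro i hi
    rcases lt_trichotomy i l with h | h | h
    · rw [cat_le (by omega), cat_le (by omega)]; exact h1 i h
    · subst h
      rw [cat_le le_rfl, cat_ge (by omega), show i + 1 - (i + 1) = 0 by omega]; exact h2
    · rw [cat_ge h, cat_ge (by omega), show r + (i + 1 - (l+1)) = r + (i - (l+1)) + 1 by omega]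
      exact h3 _ (by omega) (by omega)

theorem pforbM (C : Ctx P cls M X Y Z v n) {l r : ℕ} (hlr : l < r) (hr : r ≤ n)
    (h1 : ∀ t, t < l → M.DirEdge (v t) (v (t+1)))
    (h2 : M.DirEdge (v l) (v r)) (h3 : ∀ t, r ≤ t → t < n → M.DirEdge (v t) (v (t+1))) :
    (∀ t, 1 ≤ t → t ≤ l → ¬ An M Z (v t)) ∧ (∀ t, r ≤ t → t ≤ n → ¬ An M Z (v t)) ∧
    (l = 0 → Visible P (v 0) (v r)) :=
  C.pforb hlr hr h2.adj (fun t ht => pag_not_arr C.hP C.hM (h1 t ht)) (pag_not_arr C.hP C.hM h2)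
    (fun t ht ht' => pag_not_arr C.hP C.hM (h3 t ht ht'))

/-- Short-cutting the path must fail. -/
theorem fail (C : Ctx P cls M X Y Z v n) {l r : ℕ} (hlr : l + 2 ≤ r) (hr : r ≤ n)
    (hadj : M.Adj (v l) (v r)) :
    ((∀ t, t < l → M.DirEdge (v t) (v (t+1))) ∧ M.DirEdge (v l) (v r) ∧
      (∀ t, r ≤ t → t < n → M.DirEdge (v t) (v (t+1)))) ∨
    (1 ≤ l ∧ ¬ Ok M Z (v (l-1)) (v l) (v r)) ∨ (r < n ∧ ¬ Ok M Z (v l) (v r) (v (r+1))) := by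
  by_contra hcon
  push Not at hcon
  obtain ⟨hc1, hc2, hc3⟩ := hcon
  have hconn : Conn M Z (PMG.cat v l (fun t => v (r + t))) (l + 1 + (n - r)) := by
    refine Conn.cat (C.conn.initSeg (by omega)) (C.conn.suffix hr) hadj ?_ ?_ ?_
    · intro i j hi hj hij
      have := C.conn.inj _ _ (by omega) (by omega) hij
      omega
    · intro i hi
      have := hc2 (by omega)
      rwa [show l - 1 = i by omega] at this
    · intro h
      exact hc3 (by omega)
  have hle := C.short _ _ hconn (by rw [cat_le (by omega)]; exact C.v0)
    (by rw [cat_add, show r + (n - r) = n by omega]; exact C.vn) ?_ ?_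
  · omega
  · intro i hi1 hi2
    by_cases hil : i ≤ l
    · rw [cat_le hil]; exact C.vX i hi1 (by omega)
    · rw [cat_ge (by omega)]; exact C.vX _ (by omega) (by omega)
  · by_contra hno
    push Not at hno
    have e1 : ∀ t, t < l → M.DirEdge (v t) (v (t+1)) := by
      intro t ht
      have := hno t (by omega)
      rw [cat_le (by omega), cat_le (by omega)] at this
      exact not_arr_dir C.anc (adj_symm (C.conn.adj t (by omega))) this
    have e2 : M.DirEdge (v l) (v r) := by
      have := hno l (by omega)
      rw [cat_ge (by omega : l < l+1), cat_le le_rfl, show l + 1 - (l+1) = 0 by omega] at this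
      exact not_arr_dir C.anc (adj_symm hadj) this
    obtain ⟨t, ht1, ht2, ht3⟩ := hc1 e1 e2
    have := hno (l + 1 + (t - r)) (by omega)
    rw [show l + 1 + (t - r) + 1 = l + 1 + (t - r + 1) by omega, cat_add, cat_add,
      show r + (t - r + 1) = t + 1 by omega, show r + (t - r) = t by omega] at this
    exact ht3 (not_arr_dir C.anc (adj_symm (C.conn.adj t (by omega))) this)

end Ctx

/-- left dependency data -/
def LeftD (M : PMG V) (v : ℕ → V) (i j : ℕ) : Prop :=
  1 ≤ j ∧ j ≤ i ∧ ∀ t, j ≤ t → t < i → Cl M v t ∧ M.DirEdge (v t) (v (i+1))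

/-- right dependency data -/
def RightD (M : PMG V) (v : ℕ → V) (n i j : ℕ) : Prop :=
  i < j ∧ j < n ∧ ∀ t, i < t → t ≤ j → Cl M v t ∧ M.DirEdge (v t) (v (i-1))

/-- causal shortcut from the start -/
def CausalD (M : PMG V) (v : ℕ → V) (n i : ℕ) : Prop :=
  M.DirEdge (v 0) (v (i+1)) ∧ ∀ t, i + 1 ≤ t → t < n → M.DirEdge (v t) (v (t+1))

namespace Ctx
variable {P : PMG V} {cls : Set (PMG V)} {M : PMG V} {X Y Z : Finset V} {v : ℕ → V} {n : ℕ}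

theorem leftStep (C : Ctx P cls M X Y Z v n) {i j : ℕ} (hL : LeftD M v i j) (hji : j < i)
    (hi : i < n) (hadj : M.Adj (v (j-1)) (v (i+1))) :
    (j = 1 ∧ CausalD M v n i) ∨ LeftD M v i (j-1) := by
  obtain ⟨hj1, -, hL⟩ := hL
  have hj := hL j le_rfl hji
  have hji1 : j - 1 + 1 = j := by omega
  rcases C.fail (l := j-1) (r := i+1) (by omega) (by omega) hadj with ⟨h1, h2, h3⟩ | ⟨h1, h2⟩ | ⟨h1, h2⟩
  · by_cases hj2 : j = 1
    · left
      subst hj2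
      exact ⟨rfl, h2, h3⟩
    · exfalso
      have hf := (C.pforbM (by omega) (by omega) h1 h2 h3).1 (j-1) (by omega) le_rfl
      apply hf
      by_cases ha : M.Arr (v j) (v (j-1))
      · apply C.cl_an (by omega) (by omega)
        refine ⟨?_, by rw [hji1]; exact ha⟩
        have := (h1 (j-1-1) (by omega)).1
        rwa [show j-1-1+1 = j-1 by omega] at this
      · exact An.of_dir (not_arr_dir C.anc (adj_symm (C.adj' hj1 (by omega))) ha)
          (C.cl_an hj1 (by omega) hj.1)
  · right
    have hok := C.ok' h1 (by omega)
    rw [hji1] at hok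
    rcases okcmp hok h2 with ⟨a1, a2, a3⟩ | ⟨a1, a2, a3, a4⟩
    · refine ⟨h1, by omega, fun t ht1 ht2 => ?_⟩
      by_cases ht : t = j-1
      · subst ht
        refine ⟨⟨a1, by rw [hji1]; exact a2⟩, not_arr_dir C.anc (adj_symm hadj) a3⟩
      · exact hL t (by omega) ht2
    · exact (cyc1 C.anc a3 (not_arr_dir C.anc (adj_symm (C.adj' hj1 (by omega))) a2) hj.2).elim
  · exfalso
    have hok := (C.ok' (i := i+1) (by omega) h1)
    rw [Nat.add_sub_cancel] at hok
    rcases okcmp hok.symm (fun h => h2 h.symm) with ⟨a1, a2, a3⟩ | ⟨a1, a2, a3, a4⟩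
    · exact cyc1 C.anc hj.1.1 hj.2 (not_arr_dir C.anc hadj a3)
    · have hi1 := hL (i-1) (by omega) (by omega)
      have e := hi1.1.2
      rw [show i - 1 + 1 = i by omega] at e
      exact cyc1 C.anc e hi1.2 (not_arr_dir C.anc (C.conn.adj i hi) a2)

theorem rightStep (C : Ctx P cls M X Y Z v n) {i j : ℕ} (hi : 1 ≤ i) (hR : RightD M v n i j)
    (hadj : M.Adj (v (i-1)) (v (j+1))) : RightD M v n i (j+1) := by
  obtain ⟨hij, hjn, hR⟩ := hR
  have hj := hR j hij le_rfl
  have hi1 := hR (i+1) (by omega) (by omega)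
  have hii : i - 1 + 1 = i := by omega
  rcases C.fail (l := i-1) (r := j+1) (by omega) (by omega) hadj with ⟨h1, h2, h3⟩ | ⟨h1, h2⟩ | ⟨h1, h2⟩
  · exact (cyc1 C.anc hj.1.2 hj.2 h2).elim
  · exfalso
    have hok := C.ok' h1 (by omega)
    rw [hii] at hok
    rcases okcmp hok h2 with ⟨a1, a2, a3⟩ | ⟨a1, a2, a3, a4⟩
    · exact cyc1 C.anc hj.1.2 hj.2 (not_arr_dir C.anc (adj_symm hadj) a3)
    · exact cyc1 C.anc hi1.1.1 hi1.2 (not_arr_dir C.anc (adj_symm (C.adj' hi (by omega))) a2)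
  · have hok := (C.ok' (i := j+1) (by omega) h1)
    rw [Nat.add_sub_cancel] at hok
    rcases okcmp hok.symm (fun h => h2 h.symm) with ⟨a1, a2, a3⟩ | ⟨a1, a2, a3, a4⟩
    · refine ⟨by omega, h1, fun t ht1 ht2 => ?_⟩
      by_cases ht : t = j+1
      · subst ht
        exact ⟨⟨a2, a1⟩, not_arr_dir C.anc hadj a3⟩
      · exact hR t ht1 (by omega)
    · exact (cyc1 C.anc a3 (not_arr_dir C.anc (C.conn.adj j hjn) a2) hj.2).elim

theorem shielded_init (C : Ctx P cls M X Y Z v n) {i : ℕ} (hi1 : 1 ≤ i) (hi : i < n)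
    (hadj : M.Adj (v (i-1)) (v (i+1))) :
    (i = 1 ∧ CausalD M v n i) ∨ (2 ≤ i ∧ LeftD M v i (i-1)) ∨ RightD M v n i (i+1) := by
  have hii : i - 1 + 1 = i := by omega
  rcases C.fail (l := i-1) (r := i+1) (by omega) (by omega) hadj with ⟨h1, h2, h3⟩ | ⟨h1, h2⟩ | ⟨h1, h2⟩
  · left
    by_cases hi2 : i = 1
    · subst hi2
      exact ⟨rfl, h2, h3⟩
    · exfalso
      have hf := (C.pforbM (by omega) (by omega) h1 h2 h3).1 (i-1) (by omega) le_rfl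
      apply hf
      by_cases ha : M.Arr (v i) (v (i-1))
      · apply C.cl_an (by omega) (by omega)
        refine ⟨?_, by rw [hii]; exact ha⟩
        have := (h1 (i-1-1) (by omega)).1
        rwa [show i-1-1+1 = i-1 by omega] at this
      · have hd := not_arr_dir C.anc (adj_symm (C.adj' hi1 (by omega))) ha
        refine An.of_dir hd (C.cl_an hi1 hi ⟨hd.1, ?_⟩)
        obtain ⟨t, ht, hta⟩ := C.nc
        by_cases c1 : t < i - 1
        · exact absurd hta (h1 t c1).not_arr
        · by_cases c2 : i + 1 ≤ t
          · exact absurd hta (h3 t c2 ht).not_arr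
          · by_cases c3 : t = i
            · rw [c3] at hta; exact hta
            · obtain rfl : t = i - 1 := by omega
              rw [hii] at hta
              exact absurd hta ha
  · right; left
    have hok := C.ok' h1 (by omega)
    rw [hii] at hok
    rcases okcmp hok h2 with ⟨a1, a2, a3⟩ | ⟨a1, a2, a3, a4⟩
    · refine ⟨by omega, h1, by omega, fun t ht1 ht2 => ?_⟩
      obtain rfl : t = i-1 := by omega
      refine ⟨⟨a1, by rw [hii]; exact a2⟩, not_arr_dir C.anc (adj_symm hadj) a3⟩
    · exfalso
      have hd := not_arr_dir C.anc (adj_symm (C.adj' hi1 (by omega))) a2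
      exact a4 (An.of_dir hd (C.cl_an hi1 hi ⟨hd.1, arr_trans C.anc a3 hd (adj_symm (C.conn.adj i hi))⟩))
  · right; right
    have hok := (C.ok' (i := i+1) (by omega) h1)
    rw [Nat.add_sub_cancel] at hok
    rcases okcmp hok.symm (fun h => h2 h.symm) with ⟨a1, a2, a3⟩ | ⟨a1, a2, a3, a4⟩
    · refine ⟨by omega, h1, fun t ht1 ht2 => ?_⟩
      obtain rfl : t = i+1 := by omega
      exact ⟨⟨a2, a1⟩, not_arr_dir C.anc hadj a3⟩
    · exfalso
      have hd := not_arr_dir C.anc (C.conn.adj i hi) a2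
      exact a4 (An.of_dir hd (C.cl_an hi1 hi ⟨arr_trans C.anc a3 hd (C.adj' hi1 (by omega)), hd.1⟩))

theorem left_final (C : Ctx P cls M X Y Z v n) {i : ℕ} (hi : i < n) : ∀ j, j < i → LeftD M v i j →
    ∃ j, LeftD M v i j ∧ ((j < i ∧ ¬ M.Adj (v (j-1)) (v (i+1))) ∨ (j = 1 ∧ CausalD M v n i)) := by
  intro j
  induction j with
  | zero => intro _ h; exact absurd h.1 (by omega)
  | succ j ih =>
    intro hj hL
    by_cases hadj : M.Adj (v (j+1-1)) (v (i+1))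
    · rcases C.leftStep hL hj hi hadj with h | h
      · exact ⟨j+1, hL, Or.inr h⟩
      · exact ih (by omega) h
    · exact ⟨j+1, hL, Or.inl ⟨hj, hadj⟩⟩

theorem right_final (C : Ctx P cls M X Y Z v n) {i : ℕ} (hi : 1 ≤ i) : ∀ d j, n - j ≤ d →
    RightD M v n i j → ∃ j, RightD M v n i j ∧ ¬ M.Adj (v (i-1)) (v (j+1)) := by
  intro d
  induction d with
  | zero => intro j hd h; exact absurd h.2.1 (by omega)
  | succ d ih =>
    intro j hd hR
    by_cases hadj : M.Adj (v (i-1)) (v (j+1))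
    · exact ih (j+1) (by omega) (C.rightStep hi hR hadj)
    · exact ⟨j, hR, hadj⟩

theorem shielded (C : Ctx P cls M X Y Z v n) {i : ℕ} (hi1 : 1 ≤ i) (hi : i < n)
    (hadj : M.Adj (v (i-1)) (v (i+1))) :
    (∃ j, LeftD M v i j ∧ ((j < i ∧ ¬ M.Adj (v (j-1)) (v (i+1))) ∨ (j = 1 ∧ CausalD M v n i))) ∨
    (∃ j, RightD M v n i j ∧ ¬ M.Adj (v (i-1)) (v (j+1))) := by
  rcases C.shielded_init hi1 hi hadj with ⟨rfl, h⟩ | ⟨h1, h⟩ | h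
  · left
    exact ⟨1, ⟨le_rfl, le_rfl, fun t h1 h2 => by omega⟩, Or.inr ⟨rfl, h⟩⟩
  · left; exact C.left_final hi _ (by omega) h
  · right; exact C.right_final hi1 _ _ le_rfl h

end Ctx



section AllN
variable {P : PMG V} {cls : Set (PMG V)} {M : PMG V}

theorem status_all (hP : IsPAGOf P cls) (hM : M ∈ cls) {w c a b : V} {S : Finset V}
    (hS : ∀ N ∈ cls, Sep N w c S) (ha : ∀ N ∈ cls, Into N S w a) (haS : a ∈ S)
    (hba : ∀ N ∈ cls, N.Arr b a) (hbc : M.Adj b c) (hac : M.Adj a c) :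
    (∀ N ∈ cls, N.Arr a b ∧ N.Arr c b) ∨ (∀ N ∈ cls, N.DirEdge b c) := by
  have key := fun N (hN : N ∈ cls) => (hS N hN).status (ha N hN) haS (hba N hN)
    ((pag_adj2 hP hM hN).1 hbc) ((pag_adj2 hP hM hN).1 hac)
  by_cases hb : b ∈ S
  · right; intro N hN; exact (key N hN).1.1 hb
  · left; intro N hN; exact (key N hN).2.1 hb

theorem chain_all (hM : M ∈ cls) {w c : V} {S : Finset V}
    (hS : ∀ N ∈ cls, Sep N w c S) (u : ℕ → V) (m : ℕ)
    (h0 : ∀ N ∈ cls, Into N S w (u 0)) (hd : ∀ t, t ≤ m → M.DirEdge (u t) c)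
    (hb : ∀ N ∈ cls, ∀ t, t < m → N.Arr (u t) (u (t+1)) ∧ N.Arr (u (t+1)) (u t)) :
    ∀ t, t ≤ m → u t ∈ S ∧ ∀ N ∈ cls, Into N S w (u t) := by
  intro t ht
  refine ⟨((hS M hM).chain u m (h0 M hM) (h0 M hM) hd (hb M hM) (hb M hM) t ht).1, fun N hN => ?_⟩
  exact ((hS M hM).chain u m (h0 M hM) (h0 N hN) hd (hb M hM) (hb N hN) t ht).2.2

end AllN

/-- the status of `v i` on the path is the same in the whole class, in a way visible in the PAG. -/
def Good (cls : Set (PMG V)) (M : PMG V) (v : ℕ → V) (i : ℕ) : Prop :=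
  (∀ N ∈ cls, Cl N v i) ∨ (∀ N ∈ cls, N.DirEdge (v i) (v (i-1))) ∨
  (∀ N ∈ cls, N.DirEdge (v i) (v (i+1))) ∨
  (¬ M.Adj (v (i-1)) (v (i+1)) ∧ ∀ N ∈ cls, ¬ Cl N v i)

theorem Good.all {cls : Set (PMG V)} {M : PMG V} {v : ℕ → V} {i : ℕ} (h : Good cls M v i)
    (hM : M ∈ cls) (hc : Cl M v i) : ∀ N ∈ cls, Cl N v i := by
  rcases h with h | h | h | h
  · exact h
  · exact absurd hc.1 (h M hM).not_arr
  · exact absurd hc.2 (h M hM).not_arr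
  · exact absurd hc (h.2 M hM)

/-- consecutive colliders are joined by bidirected edges -/
theorem Cl.bidir {N : PMG V} {v : ℕ → V} {t : ℕ} (h1 : Cl N v t) (h2 : Cl N v (t+1)) :
    N.Arr (v t) (v (t+1)) ∧ N.Arr (v (t+1)) (v t) := by
  refine ⟨?_, h1.2⟩
  have := h2.1
  rwa [Nat.add_sub_cancel] at this

namespace Ctx
variable {P : PMG V} {cls : Set (PMG V)} {M : PMG V} {X Y Z : Finset V} {v : ℕ → V} {n : ℕ}

theorem ne' (C : Ctx P cls M X Y Z v n) {i j : ℕ} (hi : i ≤ n) (hj : j ≤ n) (h : i ≠ j) :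
    v i ≠ v j := fun h' => h (C.conn.inj i j hi hj h')

theorem unsh_good (C : Ctx P cls M X Y Z v n) {i : ℕ} (h1 : 1 ≤ i) (h2 : i < n)
    (h : ¬ M.Adj (v (i-1)) (v (i+1))) : Good cls M v i := by
  obtain ⟨S, hS⟩ := pag_sep C.hP C.hM (C.ne' (by omega) (by omega) (by omega)) h
  have key := fun N (hN : N ∈ cls) => (hS N hN).unsh
    ((pag_adj2 C.hP C.hM hN).1 (C.adj' h1 (by omega)))
    ((pag_adj2 C.hP C.hM hN).1 (C.conn.adj i h2))
  by_cases hb : v i ∈ S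
  · right; right; right
    exact ⟨h, fun N hN hc => (key N hN).2 hc hb⟩
  · left; intro N hN; exact (key N hN).1 hb

theorem right_good (C : Ctx P cls M X Y Z v n) {i j : ℕ} (h1 : 1 ≤ i)
    (hR : RightD M v n i j) (hadj : ¬ M.Adj (v (i-1)) (v (j+1)))
    (hdep : ∀ t, i < t → t ≤ j → ∀ N ∈ cls, Cl N v t) : Good cls M v i := by
  obtain ⟨hij, hjn, hR⟩ := hR
  obtain ⟨S, hS⟩ := pag_sep C.hP C.hM (C.ne' (i := j+1) (j := i-1) (by omega) (by omega) (by omega))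
    (fun h => hadj (adj_symm h))
  have hch := chain_all C.hM hS (fun t => v (j - t)) (j - (i+1)) ?_ ?_ ?_ (j - (i+1)) le_rfl
  · simp only [show j - (j - (i+1)) = i + 1 by omega] at hch
    rcases status_all C.hP C.hM hS hch.2 hch.1 (b := v i)
      (fun N hN => by simpa using (hdep (i+1) (by omega) (by omega) N hN).1)
      (adj_symm (C.adj' h1 (by omega))) (hR (i+1) (by omega) (by omega)).2.adj with h | h
    · left; intro N hN; exact ⟨(h N hN).2, (h N hN).1⟩
    · right; left; exact h
  · intro N hN; exact .base (hdep j hij le_rfl N hN).2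
  · intro t ht; exact (hR (j - t) (by omega) (by omega)).2
  · intro N hN t ht
    have := Cl.bidir (t := j - (t+1)) (hdep _ (by omega) (by omega) N hN)
      (hdep _ (by omega) (by omega) N hN)
    simp only [show j - (t+1) + 1 = j - t by omega] at this
    exact this.symm

theorem left_good (C : Ctx P cls M X Y Z v n) {i j : ℕ} (hi : i < n)
    (hL : LeftD M v i j) (hji : j < i) (hadj : ¬ M.Adj (v (j-1)) (v (i+1)))
    (hdep : ∀ t, j ≤ t → t < i → ∀ N ∈ cls, Cl N v t) : Good cls M v i := by
  obtain ⟨hj1, -, hL⟩ := hL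
  obtain ⟨S, hS⟩ := pag_sep C.hP C.hM (C.ne' (i := j-1) (j := i+1) (by omega) (by omega) (by omega))
    hadj
  have hch := chain_all C.hM hS (fun t => v (j + t)) (i - 1 - j) ?_ ?_ ?_ (i - 1 - j) le_rfl
  · simp only [show j + (i - 1 - j) = i - 1 by omega] at hch
    rcases status_all C.hP C.hM hS hch.2 hch.1 (b := v i)
      (fun N hN => by
        have := (hdep (i-1) (by omega) (by omega) N hN).2
        rwa [show i - 1 + 1 = i by omega] at this)
      (C.conn.adj i hi) (hL (i-1) (by omega) (by omega)).2.adj with h | h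
    · left; exact h
    · right; right; left; exact h
  · intro N hN; exact .base (hdep j le_rfl hji N hN).1
  · intro t ht; exact (hL (j + t) (by omega) (by omega)).2
  · intro N hN t ht
    exact Cl.bidir (t := j + t) (hdep _ (by omega) (by omega) N hN)
      (hdep _ (by omega) (by omega) N hN)

end Ctx


/-- witness of visibility of `x → c`. -/
structure VisSeq (P : PMG V) (x c : V) (d : ℕ → V) (m : ℕ) : Prop where
  hm : 1 ≤ m
  last : d m = x
  ne : d 0 ≠ c
  nadj : ¬ P.Adj (d 0) c
  fwd : ∀ t, t < m → P.Arr (d t) (d (t+1))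
  bwd : ∀ t, 1 ≤ t → t < m → P.Arr (d (t+1)) (d t)
  par : ∀ t, 1 ≤ t → t ≤ m → P.DirEdge (d t) c

theorem Visible.seq {P : PMG V} {x c : V} (h : Visible P x c) : ∃ d m, VisSeq P x c d m := by
  obtain ⟨hxc, w, hne, hadj, h | h⟩ := h
  · refine ⟨fun t => if t = 0 then w else x, 1, le_rfl, by simp, by simpa using hne,
      by simpa using hadj, ?_, ?_, ?_⟩
    · intro t ht
      obtain rfl : t = 0 := by omega
      simpa using h
    · intro t h1 h2; omega
    · intro t h1 h2
      obtain rfl : t = 1 := by omega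
      simpa using hxc
  · obtain ⟨p, ⟨hp, hh, hl, hlen⟩, hcol, ⟨a, ha, hax⟩, hpar⟩ := h
    obtain ⟨f, n, rfl⟩ := exists_Lf p hp.1
    rw [Lf_head] at hh; rw [Lf_last] at hl
    rw [Lf_length] at *
    have hp' := Lf_isPath.1 hp
    obtain ⟨_, rfl⟩ := Lf_get_some.1 ha
    simp only [Option.some.injEq] at hh hl
    subst hh; subst hl
    refine ⟨f, n, by omega, rfl, hne, hadj, ?_, ?_, ?_⟩
    · intro t ht
      by_cases h2 : t + 2 ≤ n
      · exact (Lf_coll.1 (hcol t (by omega))).2.1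
      · obtain rfl : n = t + 1 := by omega
        exact hax
    · intro t h1 h2
      have := (Lf_coll.1 (hcol (t-1) (by omega))).2.2
      rwa [show t - 1 + 2 = t + 1 by omega, show t - 1 + 1 = t by omega] at this
    · intro t h1 h2
      by_cases h3 : t = n
      · rw [h3]; exact hxc
      · refine hpar _ (Lf_mem.2 ⟨t, h2, rfl⟩) ?_ ?_
        · intro h; have := hp'.2 _ _ (by omega) (by omega) h; omega
        · intro h; have := hp'.2 _ _ (by omega) (by omega) h; omega

section
variable {P : PMG V} {cls : Set (PMG V)} {M : PMG V}

theorem VisSeq.into {x c : V} {d : ℕ → V} {m : ℕ} (hv : VisSeq P x c d m) (hP : IsPAGOf P cls)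
    (hM : M ∈ cls) : ∃ S, (∀ N ∈ cls, Sep N (d 0) c S) ∧
      ∀ t, 1 ≤ t → t ≤ m → d t ∈ S ∧ ∀ N ∈ cls, Into N S (d 0) (d t) := by
  obtain ⟨S, hS⟩ := pag_sep hP hM hv.ne (fun h => hv.nadj ((pag_adj hP hM).2 h))
  have hm := hv.hm
  refine ⟨S, hS, fun t h1 h2 => ?_⟩
  have := chain_all hM hS (fun t => d (1 + t)) (m - 1) ?_ ?_ ?_ (t - 1) (by omega)
  · simpa only [show 1 + (t - 1) = t by omega] using this
  · intro N hN; exact .base (pag_arr hP hN (hv.fwd 0 (by omega)))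
  · intro t ht; exact pag_dir hP hM (hv.par _ (by omega) (by omega))
  · intro N hN t ht
    exact ⟨pag_arr hP hN (hv.fwd (1+t) (by omega)), pag_arr hP hN (hv.bwd (1+t) (by omega) (by omega))⟩

theorem VisSeq.disc {x c : V} {d : ℕ → V} {m : ℕ} (hv : VisSeq P x c d m) (hP : IsPAGOf P cls)
    (hM : M ∈ cls) {S : Finset V} (hS : ∀ N ∈ cls, Sep N (d 0) c S)
    (hin : ∀ t, 1 ≤ t → t ≤ m → d t ∈ S ∧ ∀ N ∈ cls, Into N S (d 0) (d t))
    {b : V} (hbS : b ∈ S) (hbc : M.Adj b c) (hbx : M.Arr b (d m)) {N : PMG V} (hN : N ∈ cls)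
    (hcb : N.Arr c b) : False := by
  have hA := pag_anc hP hN
  have hm := hv.hm
  have H : ¬ Into N S (d 0) b := by
    intro h
    exact (((hS N hN).blocked h ((pag_adj2 hP hM hN).1 hbc)).1 hbS).not_arr hcb
  have hbw : b ≠ d 0 := by rintro rfl; exact (hS M hM).nadj hbc
  have hstep : ∀ t, 1 ≤ t → t ≤ m → N.Arr (d t) b → N.DirEdge (d t) b := by
    intro t h1 h2 h3
    apply not_arr_dir hA (adj_symm h3.adj)
    intro h4
    exact H (.step ((hin t h1 h2).2 N hN) (hin t h1 h2).1 h3 h4 hbw)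
  -- one step down
  have hdown : ∀ t, t < m → (∀ s, t < s → s ≤ m → N.DirEdge (d s) b) → N.Arr (d t) b := by
    intro t ht hs
    have hne : d t ≠ b := by
      by_cases h0 : t = 0
      · rw [h0]; exact hbw.symm
      · intro h
        exact H (h ▸ (hin t (by omega) (by omega)).2 N hN)
    by_cases hadj : M.Adj (d t) b
    · exact arr_trans hA (pag_arr hP hN (hv.fwd t ht)) (hs (t+1) (by omega) (by omega))
        ((pag_adj2 hP hM hN).1 hadj)
    · exfalso
      obtain ⟨S2, hS2⟩ := pag_sep hP hM hne hadj
      have := (hS2 N hN).chain (N := M) (fun s => d (t + 1 + s)) (m - t - 1)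
        (.base (pag_arr hP hN (hv.fwd t ht))) (.base (pag_arr hP hM (hv.fwd t ht)))
        (fun s hs' => hs _ (by omega) (by omega))
        (fun s hs' => ⟨pag_arr hP hN (hv.fwd _ (by omega)),
          pag_arr hP hN (hv.bwd (t+1+s) (by omega) (by omega))⟩)
        (fun s hs' => ⟨pag_arr hP hM (hv.fwd _ (by omega)),
          pag_arr hP hM (hv.bwd (t+1+s) (by omega) (by omega))⟩) (m - t - 1) le_rfl
      simp only [show t + 1 + (m - t - 1) = m by omega] at this
      exact (((hS2 M hM).blocked this.2.2 (adj_symm hbx.adj)).1 this.1).not_arr hbx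
  have hall : ∀ k, k < m → ∀ s, m - k ≤ s → s ≤ m → N.DirEdge (d s) b := by
    intro k
    induction k with
    | zero =>
      intro _ s h1 h2
      obtain rfl : s = m := by omega
      apply hstep s hm le_rfl
      by_contra h3
      exact cyc1 hA hcb (not_arr_dir hA (adj_symm ((pag_adj2 hP hM hN).1 hbx.adj)) h3)
        (pag_dir hP hN (hv.par s hm le_rfl))
    | succ k ih =>
      intro hk s h1 h2
      by_cases h3 : m - k ≤ s
      · exact ih (by omega) s h3 h2
      · apply hstep s (by omega) h2
        exact hdown s (by omega) (fun s' h4 h5 => ih (by omega) s' (by omega) h5)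
  exact H (.base (hdown 0 (by omega) (fun s h1 h2 => hall (m-1) (by omega) s (by omega) h2)))

end

namespace Ctx
variable {P : PMG V} {cls : Set (PMG V)} {M : PMG V} {X Y Z : Finset V} {v : ℕ → V} {n : ℕ}

theorem causal_good (C : Ctx P cls M X Y Z v n) {i : ℕ} (hi1 : 1 ≤ i) (hi : i < n)
    (hL : LeftD M v i 1) (hC : CausalD M v n i)
    (hdep : ∀ t, 1 ≤ t → t < i → ∀ N ∈ cls, Cl N v t) : Good cls M v i := by
  obtain ⟨-, -, hL⟩ := hL
  have hvis := (C.pforbM (l := 0) (r := i+1) (by omega) (by omega) (fun t ht => by omega) hC.1 hC.2).2.2 rfl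
  obtain ⟨d, m, hv⟩ := hvis.seq
  obtain ⟨S, hS, hin⟩ := hv.into C.hP C.hM
  have hx := hin m hv.hm le_rfl
  rw [hv.last] at hx
  have hPd : ∀ t, i + 1 ≤ t → t < n → ¬ P.Arr (v (t+1)) (v t) := fun t h1 h2 =>
    pag_not_arr C.hP C.hM (hC.2 t h1 h2)
  by_cases hA : P.Arr (v 1) (v 0)
  · have hA' : ∀ N ∈ cls, N.Arr (v 1) (v 0) := fun N hN => pag_arr C.hP hN hA
    have hch := chain_all C.hM hS v (i - 1) hx.2 ?_ ?_ (i - 1) le_rfl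
    · have e1 : ∀ N ∈ cls, N.Arr (v i) (v (i-1)) := by
        intro N hN
        by_cases h : i = 1
        · subst h; exact hA' N hN
        · have := (hdep (i-1) (by omega) (by omega) N hN).2
          rwa [show i - 1 + 1 = i by omega] at this
      have e2 : M.Adj (v (i-1)) (v (i+1)) := by
        by_cases h : i = 1
        · subst h; exact hC.1.adj
        · exact (hL (i-1) (by omega) (by omega)).2.adj
      rcases status_all C.hP C.hM hS hch.2 hch.1 e1 (C.conn.adj i hi) e2 with h | h
      · left; exact h
      · right; right; left; exact h
    · intro t ht
      by_cases h : t = 0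
      · subst h; exact hC.1
      · exact (hL t (by omega) (by omega)).2
    · intro N hN t ht
      by_cases h : t = 0
      · subst h
        exact ⟨(hdep 1 (by omega) (by omega) N hN).1, hA' N hN⟩
      · exact Cl.bidir (hdep t (by omega) (by omega) N hN) (hdep (t+1) (by omega) (by omega) N hN)
  · have hadj01 : M.Adj (v 0) (v 1) := C.conn.adj 0 (by omega)
    by_cases hi2 : 2 ≤ i
    · exfalso
      have h1 := hL 1 le_rfl (by omega)
      refine (C.pforb (l := 1) (r := i+1) (by omega) (by omega) h1.2.adj ?_
        (pag_not_arr C.hP C.hM h1.2) hPd).1 1 le_rfl le_rfl (C.cl_an le_rfl (by omega) h1.1)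
      intro t ht
      obtain rfl : t = 0 := by omega
      exact hA
    · obtain rfl : i = 1 := by omega
      have hadj12 : M.Adj (v 1) (v 2) := C.conn.adj 1 (by omega)
      by_cases hcl : Cl M v 1
      · have h21 : P.Arr (v 2) (v 1) := by
          by_contra h21
          refine (C.pforb (l := 0) (r := 1) (by omega) (by omega) hadj01 (fun t ht => by omega)
            hA ?_).2.1 1 le_rfl (by omega) (C.cl_an le_rfl (by omega) hcl)
          intro t h1 h2
          by_cases h : t = 1
          · subst h; exact h21
          · exact hPd t (by omega) h2
        left
        intro N hN
        refine ⟨?_, pag_arr C.hP hN h21⟩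
        by_contra h
        have hAN := pag_anc C.hP hN
        exact cyc1 hAN (pag_arr C.hP hN h21)
          (not_arr_dir hAN ((pag_adj2 C.hP C.hM hN).1 hadj01) h)
          (pag_dir C.hP hN hvis.1)
      · have h21 : ¬ M.Arr (v 2) (v 1) := by
          intro h
          have : ¬ M.Arr (v 0) (v 1) := fun h' => hcl ⟨h', h⟩
          exact cyc1 C.anc h (not_arr_dir C.anc hadj01 this) hC.1
        have h10 : M.Arr (v 1) (v 0) := by
          obtain ⟨t, ht, hta⟩ := C.nc
          by_cases c1 : t = 0
          · subst c1; exact hta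
          · by_cases c2 : t = 1
            · subst c2; exact absurd hta h21
            · exact absurd hta (hC.2 t (by omega) ht).not_arr
        have hd12 : M.DirEdge (v 1) (v 2) := not_arr_dir C.anc (adj_symm hadj12) h21
        have hbS : v 1 ∈ S :=
          ((hS M C.hM).status (hx.2 M C.hM) hx.1 h10 hd12.adj hC.1.adj).1.2 hd12
        right; right; left
        intro N hN
        have hAN := pag_anc C.hP hN
        apply not_arr_dir hAN (adj_symm ((pag_adj2 C.hP C.hM hN).1 hadj12))
        intro h
        exact hv.disc C.hP C.hM hS hin hbS hadj12 (by rw [hv.last]; exact h10) hN h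

end Ctx


/-- terminated left dependency -/
def LT' (M : PMG V) (v : ℕ → V) (n i j : ℕ) : Prop :=
  LeftD M v i j ∧ ((j < i ∧ ¬ M.Adj (v (j-1)) (v (i+1))) ∨ (j = 1 ∧ CausalD M v n i))

/-- terminated right dependency -/
def RT' (M : PMG V) (v : ℕ → V) (n i j : ℕ) : Prop :=
  RightD M v n i j ∧ ¬ M.Adj (v (i-1)) (v (j+1))

namespace Ctx
variable {P : PMG V} {cls : Set (PMG V)} {M : PMG V} {X Y Z : Finset V} {v : ℕ → V} {n : ℕ}

theorem bad_dep (C : Ctx P cls M X Y Z v n) {i : ℕ} (hi1 : 1 ≤ i) (hi : i < n)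
    (hbad : ¬ Good cls M v i) :
    (∃ j e, LT' M v n i j ∧ j ≤ e ∧ e < i ∧ ¬ Good cls M v e) ∨
    (∃ j e, RT' M v n i j ∧ i < e ∧ e ≤ j ∧ ¬ Good cls M v e) := by
  by_cases hadj : M.Adj (v (i-1)) (v (i+1))
  · rcases C.shielded hi1 hi hadj with ⟨j, hj⟩ | ⟨j, hj⟩
    · left
      by_contra hcon
      have hg : ∀ e, j ≤ e → e < i → ∀ N ∈ cls, Cl N v e := by
        intro e h1 h2
        have : Good cls M v e := by
          by_contra h3
          exact hcon ⟨j, e, hj, h1, h2, h3⟩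
        exact this.all C.hM (hj.1.2.2 e h1 h2).1
      rcases hj.2 with ⟨h1, h2⟩ | ⟨rfl, h2⟩
      · exact hbad (C.left_good hi hj.1 h1 h2 hg)
      · exact hbad (C.causal_good hi1 hi hj.1 h2 hg)
    · right
      by_contra hcon
      refine hbad (C.right_good hi1 hj.1 hj.2 fun e h1 h2 => ?_)
      have : Good cls M v e := by
        by_contra h3
        exact hcon ⟨j, e, hj, h1, h2, h3⟩
      exact this.all C.hM (hj.1.2.2 e h1 h2).1
  · exact absurd (C.unsh_good hi1 hi hadj) hbad

theorem f1 (C : Ctx P cls M X Y Z v n) {k jk e j : ℕ} (hk : 1 ≤ k) (hR : RightD M v n k jk)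
    (h1 : k < e) (h2 : e ≤ jk) (hL : LT' M v n e j) (hjk : j ≤ k) : False := by
  obtain ⟨-, hjn, hR⟩ := hR
  have he := hR e h1 h2
  obtain ⟨⟨hj1, -, hL⟩, hfin⟩ := hL
  by_cases hj : j + 1 ≤ k
  · exact cyc1 C.anc he.1.2 he.2 (hL (k-1) (by omega) (by omega)).2
  · obtain rfl : j = k := by omega
    rcases hfin with ⟨_, hadj⟩ | ⟨rfl, hc⟩
    · obtain ⟨S, hS⟩ := pag_sep C.hP C.hM (C.ne' (i := j-1) (j := e+1) (by omega) (by omega) (by omega)) hadj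
      have hs := hS M C.hM
      have hch := hs.chain (N := M) (fun t => v (j + t)) (e - 1 - j)
        (.base (hL j le_rfl h1).1.1) (.base (hL j le_rfl h1).1.1)
        (fun t ht => (hL (j + t) (by omega) (by omega)).2)
        (fun t ht => Cl.bidir (t := j + t) (hL _ (by omega) (by omega)).1 (hL _ (by omega) (by omega)).1)
        (fun t ht => Cl.bidir (t := j + t) (hL _ (by omega) (by omega)).1 (hL _ (by omega) (by omega)).1)
        (e - 1 - j) le_rfl
      simp only [show j + (e - 1 - j) = e - 1 by omega] at hch
      have hea := (hL (e-1) (by omega) (by omega)).1.2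
      rw [show e - 1 + 1 = e by omega] at hea
      have hinto := hch.2.1.step hch.1 he.1.1 hea (C.ne' (by omega) (by omega) (by omega))
      have hn : v e ∉ S := fun h => ((hs.blocked hinto (adj_symm he.1.2.adj)).1 h).not_arr he.1.2
      exact he.2.not_arr ((hs.unsh (adj_symm he.2.adj) (adj_symm he.1.2.adj)).1 hn).1
    · exact cyc1 C.anc he.1.2 he.2 hc.1

theorem no_right (C : Ctx P cls M X Y Z v n) : ∀ N k, n - k ≤ N → 1 ≤ k → ∀ j e, RT' M v n k j →
    k < e → e ≤ j → ¬ Good cls M v e → False := by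
  intro N
  induction N with
  | zero => intro k h1 h2 j e hR _ _ _; have := hR.1.2.1; have := hR.1.1; omega
  | succ N ih =>
    intro k hN hk j e0 hR h1 h2 hbad
    have hex : ∃ e, k < e ∧ ¬ Good cls M v e := ⟨e0, h1, hbad⟩
    obtain ⟨hke, hbe⟩ := Nat.find_spec hex
    have hle : Nat.find hex ≤ e0 := Nat.find_min' hex ⟨h1, hbad⟩
    have hmin : ∀ e, e < Nat.find hex → ¬ (k < e ∧ ¬ Good cls M v e) := fun e he => Nat.find_min hex he
    generalize Nat.find hex = e at *
    have hjn := hR.1.2.1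
    rcases C.bad_dep (by omega) (by omega) hbe with ⟨j', e2, hL, a1, a2, a3⟩ | ⟨j', e2, hR', a1, a2, a3⟩
    · by_cases hc : j' ≤ k
      · exact C.f1 hk hR.1 hke (by omega) hL hc
      · exact hmin e2 a2 ⟨by omega, a3⟩
    · exact ih e (by omega) (by omega) j' e2 hR' a1 a2 a3

theorem all_good (C : Ctx P cls M X Y Z v n) : ∀ i, 1 ≤ i → i < n → Good cls M v i := by
  intro i
  induction i using Nat.strong_induction_on with
  | _ i ih =>
    intro h1 h2
    by_contra hbad
    rcases C.bad_dep h1 h2 hbad with ⟨j', e2, hL, a1, a2, a3⟩ | ⟨j', e2, hR', a1, a2, a3⟩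
    · exact a3 (ih e2 a2 (by have := hL.1.1; omega) (by omega))
    · exact C.no_right _ i le_rfl h1 j' e2 hR' a1 a2 a3

end Ctx


/-- a directed walk of length `k` from `q` into `Z`. -/
def Dn (M : PMG V) (Z : Finset V) (q : V) (k : ℕ) : Prop :=
  ∃ g : ℕ → V, g 0 = q ∧ g k ∈ Z ∧ ∀ i, i < k → M.DirEdge (g i) (g (i+1))

theorem distZ_eq {M : PMG V} (hA : IsAncestral M) (Z : Finset V) (q : V) :
    distZ M Z q = sInf {k | Dn M Z q k} := by
  unfold distZ
  congr 1
  ext k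
  constructor
  · rintro ⟨p, hp, hd, hh, ⟨z, hz, hl⟩, hlen⟩
    obtain ⟨f, n, rfl⟩ := exists_Lf p hp.1
    rw [Lf_head] at hh; rw [Lf_last] at hl; rw [Lf_length] at hlen
    simp only [Option.some.injEq] at hh hl
    obtain rfl : n = k := by omega
    exact ⟨f, hh, hl ▸ hz, Lf_dir.1 hd⟩
  · rintro ⟨g, h0, hk, hd⟩
    have hlt : ∀ i j, i < j → j ≤ k → g i ≠ g j := by
      intro i j hij hj h
      refine anc_cyc hA (hd i (by omega)).1 ?_
      rw [h]
      refine rtg_iff_fun.2 ⟨fun t => g (i + 1 + t), j - (i+1), rfl, ?_, ?_⟩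
      · show g _ = g _
        congr 1; omega
      · intro t ht; exact hd (i + 1 + t) (by omega)
    refine ⟨Lf g k, Lf_isPath.2 ⟨fun i hi => (hd i hi).adj, ?_⟩, Lf_dir.2 hd, ?_, ⟨_, hk, Lf_last _ _⟩,
      Lf_length _ _⟩
    · intro i j hi hj h
      rcases lt_trichotomy i j with h1 | h1 | h1
      · exact absurd h (hlt i j h1 hj)
      · exact h1
      · exact absurd h.symm (hlt j i h1 hi)
    · rw [Lf_head, h0]

theorem An.dn {M : PMG V} {Z : Finset V} {q : V} (h : An M Z q) : ∃ k, Dn M Z q k := by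
  obtain ⟨z, hz, hd⟩ := h
  obtain ⟨g, k, h0, hk, hd⟩ := rtg_iff_fun.1 (desc_iff.1 hd)
  exact ⟨k, g, h0, hk ▸ hz, hd⟩

theorem Dn.an {M : PMG V} {Z : Finset V} {q : V} {k : ℕ} (h : Dn M Z q k) : An M Z q := by
  obtain ⟨g, h0, hk, hd⟩ := h
  exact ⟨g k, hk, desc_iff.2 (rtg_iff_fun.2 ⟨g, k, h0, rfl, hd⟩)⟩

theorem dn_distZ {M : PMG V} (hA : IsAncestral M) {Z : Finset V} {q : V} (h : An M Z q) :
    Dn M Z q (distZ M Z q) := by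
  rw [distZ_eq hA]
  exact Nat.sInf_mem (s := {k | Dn M Z q k}) h.dn

theorem distZ_le {M : PMG V} (hA : IsAncestral M) {Z : Finset V} {q : V} {k : ℕ} (h : Dn M Z q k) :
    distZ M Z q ≤ k := by
  rw [distZ_eq hA]
  exact Nat.sInf_le h

theorem distZ_dir {M : PMG V} (hA : IsAncestral M) {Z : Finset V} {a b : V} (h : M.DirEdge a b)
    (hb : An M Z b) : distZ M Z a ≤ distZ M Z b + 1 := by
  obtain ⟨g, h0, hk, hd⟩ := dn_distZ hA hb
  refine distZ_le hA ⟨fun t => if t = 0 then a else g (t - 1), by simp, by simpa using hk, ?_⟩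
  intro i hi
  by_cases h1 : i = 0
  · subst h1; simpa [h0] using h
  · have := hd (i-1) (by omega)
    simpa [h1, show i - 1 + 1 = i by omega] using this

theorem distZ_step {M : PMG V} (hA : IsAncestral M) {Z : Finset V} {b : V} (hb : An M Z b)
    (hbZ : b ∉ Z) : ∃ s, M.DirEdge b s ∧ An M Z s ∧ distZ M Z b = distZ M Z s + 1 := by
  obtain ⟨g, h0, hk, hd⟩ := dn_distZ hA hb
  have hpos : 1 ≤ distZ M Z b := by
    by_contra h
    rw [show distZ M Z b = 0 by omega, h0] at hk
    exact hbZ hk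
  have hdn : Dn M Z (g 1) (distZ M Z b - 1) := by
    refine ⟨fun t => g (1 + t), rfl, ?_, fun i hi => hd (1 + i) (by omega)⟩
    simpa only [show 1 + (distZ M Z b - 1) = distZ M Z b by omega] using hk
  have hd0 : M.DirEdge b (g 1) := by
    have := hd 0 (by omega)
    rwa [h0] at this
  refine ⟨g 1, hd0, hdn.an, ?_⟩
  have h1 := distZ_le hA hdn
  have h2 := distZ_dir hA hd0 hdn.an
  omega

theorem claimE {P : PMG V} {cls : Set (PMG V)} {M : PMG V} (hP : IsPAGOf P cls) (hM : M ∈ cls)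
    {Z : Finset V} : ∀ k b s, P.DirEdge b s → An M Z s → distZ M Z s = k → distZ M Z b = k + 1 →
    ∃ z ∈ Z, ReflTransGen P.DirEdge s z := by
  have hA := pag_anc hP hM
  intro k
  induction k with
  | zero =>
    intro b s _ hs hk _
    obtain ⟨g, h0, hk', _⟩ := dn_distZ hA hs
    rw [hk, h0] at hk'
    exact ⟨s, hk', .refl⟩
  | succ k ih =>
    intro b s hbs hs hk hb
    by_cases hsZ : s ∈ Z
    · exact ⟨s, hsZ, .refl⟩
    · obtain ⟨s', hss, hs', hk'⟩ := distZ_step hA hs hsZ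
      have hne : b ≠ s' := by rintro rfl; omega
      have hbsM := pag_dir hP hM hbs
      have hadj : ¬ M.Adj b s' := by
        intro h
        have := distZ_dir hA (dir_dir_adj hA hbsM hss h) hs'
        omega
      obtain ⟨S, hS⟩ := pag_sep hP hM hne hadj
      have hsS : s ∈ S := by
        by_contra h
        exact hss.not_arr (((hS M hM).unsh hbsM.adj hss.adj).1 h).2
      have hPd : P.DirEdge s s' := by
        apply pag_dir_of hP hM
        intro N hN
        have hAN := pag_anc hP hN
        have hadjN := (pag_adj2 hP hM hN).1 hss.adj
        apply not_arr_dir hAN (adj_symm hadjN)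
        intro h
        exact (((hS N hN).unsh (pag_dir hP hN hbs).adj hadjN).2 ⟨(pag_dir hP hN hbs).1, h⟩) hsS
      obtain ⟨z, hz, hr⟩ := ih s s' hPd hs' (by omega) hk
      exact ⟨z, hz, .head hPd hr⟩

/-- left end of the run of colliders that are parents of `s`. -/
structure LEnd (M : PMG V) (Z : Finset V) (v : ℕ → V) (i : ℕ) (s : V) (j : ℕ) : Prop where
  h1 : 1 ≤ j
  h2 : j ≤ i
  arr : M.Arr (v (j-1)) s
  imp : M.Arr s (v (j-1)) → M.Arr (v j) (v (j-1))
  ok : 2 ≤ j → Ok M Z (v (j-1-1)) (v (j-1)) s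
  adj : ∀ t, j ≤ t → t ≤ i → M.Adj (v t) s

/-- right end of the run of colliders that are parents of `s`. -/
structure REnd (M : PMG V) (Z : Finset V) (v : ℕ → V) (n i : ℕ) (s : V) (k : ℕ) : Prop where
  h1 : i ≤ k
  h2 : k < n
  arr : M.Arr (v (k+1)) s
  imp : M.Arr s (v (k+1)) → M.Arr (v k) (v (k+1))
  ok : k + 2 ≤ n → Ok M Z s (v (k+1)) (v (k+2))
  adj : ∀ t, i ≤ t → t ≤ k → M.Adj (v t) s

theorem ok_end {M : PMG V} (hA : IsAncestral M) {Z : Finset V} {a b c s : V}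
    (h : Ok M Z a b c) (hd : M.DirEdge c s) (hadj : M.Adj c b) (hbs : M.Adj b s)
    (hn : ¬ ((M.Arr a b ∧ M.Arr c b) ∧ M.DirEdge b s)) : Ok M Z a b s := by
  by_cases h1 : M.Arr s b
  · have h2 : M.Arr c b := by
      by_contra h2
      exact cyc1 hA h1 (not_arr_dir hA hadj h2) hd
    unfold Ok at *
    tauto
  · have h2 := not_arr_dir hA (adj_symm hbs) h1
    unfold Ok at *
    tauto

namespace Ctx
variable {P : PMG V} {cls : Set (PMG V)} {M : PMG V} {X Y Z : Finset V} {v : ℕ → V} {n : ℕ}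

theorem lend_aux (C : Ctx P cls M X Y Z v n) {i : ℕ} (hi : i < n) {s : V} {N : PMG V} (hN : N ∈ cls)
    (hsN : N.Arr s (v i)) : ∀ j, 1 ≤ j → j ≤ i →
    (∀ t, j ≤ t → t ≤ i → Cl M v t ∧ M.DirEdge (v t) s) → ∃ j, LEnd M Z v i s j := by
  intro j
  induction j with
  | zero => intro h; omega
  | succ j ih =>
    intro h1 h2 hall
    by_cases hc : 1 ≤ j ∧ Cl M v j ∧ M.DirEdge (v j) s
    · refine ih hc.1 (by omega) fun t ht1 ht2 => ?_
      by_cases h : t = j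
      · rw [h]; exact hc.2
      · exact hall t (by omega) ht2
    · have hj := hall (j+1) le_rfl h2
      have hja : M.Arr (v j) (v (j+1)) := by simpa using hj.1.1
      have hne : v j ≠ s := by
        rintro h
        rw [← h] at hj
        exact hj.2.not_arr hja
      have hadj : M.Adj (v j) s := by
        by_contra hadj
        obtain ⟨S, hS⟩ := pag_sep C.hP C.hM hne hadj
        have hg : ∀ N ∈ cls, ∀ t, j + 1 ≤ t → t ≤ i → Cl N v t := fun N hN t h3 h4 =>
          (C.all_good t (by omega) (by omega)).all C.hM (hall t h3 h4).1 N hN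
        have hch := chain_all C.hM hS (fun t => v (j + 1 + t)) (i - (j+1)) ?_ ?_ ?_ (i - (j+1)) le_rfl
        · simp only [show j + 1 + (i - (j+1)) = i by omega] at hch
          exact (((hS N hN).blocked (hch.2 N hN) (adj_symm hsN.adj)).1 hch.1).not_arr hsN
        · intro N hN
          have := (hg N hN (j+1) le_rfl h2).1
          exact .base (by simpa using this)
        · intro t ht; exact (hall _ (by omega) (by omega)).2
        · intro N hN t ht
          exact Cl.bidir (t := j + 1 + t) (hg N hN _ (by omega) (by omega)) (hg N hN _ (by omega) (by omega))
      refine ⟨j+1, h1, h2, ?_, ?_, ?_, fun t ht1 ht2 => (hall t ht1 ht2).2.adj⟩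
      · simp only [Nat.add_sub_cancel]; exact arr_trans C.anc hja hj.2 hadj
      · simp only [Nat.add_sub_cancel]
        intro h
        by_contra h3
        exact cyc1 C.anc h (not_arr_dir C.anc (adj_symm hja.adj) h3) hj.2
      · intro hj2
        simp only [Nat.add_sub_cancel]
        refine ok_end C.anc (C.ok' (by omega) (by omega)) hj.2 (adj_symm hja.adj) hadj ?_
        intro h
        exact hc ⟨by omega, h.1, h.2⟩

theorem rend_aux (C : Ctx P cls M X Y Z v n) {i : ℕ} (hi : 1 ≤ i) {s : V} {N : PMG V} (hN : N ∈ cls)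
    (hsN : N.Arr s (v i)) : ∀ d k, n - k ≤ d → i ≤ k → k < n →
    (∀ t, i ≤ t → t ≤ k → Cl M v t ∧ M.DirEdge (v t) s) → ∃ k, REnd M Z v n i s k := by
  intro d
  induction d with
  | zero => intro k h; omega
  | succ d ih =>
    intro k hd h1 h2 hall
    by_cases hc : k + 1 < n ∧ Cl M v (k+1) ∧ M.DirEdge (v (k+1)) s
    · refine ih (k+1) (by omega) (by omega) hc.1 fun t ht1 ht2 => ?_
      by_cases h : t = k + 1
      · rw [h]; exact hc.2
      · exact hall t ht1 (by omega)
    · have hk := hall k h1 le_rfl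
      have hka : M.Arr (v (k+1)) (v k) := hk.1.2
      have hne : v (k+1) ≠ s := by
        rintro h
        rw [← h] at hk
        exact hk.2.not_arr hka
      have hadj : M.Adj (v (k+1)) s := by
        by_contra hadj
        obtain ⟨S, hS⟩ := pag_sep C.hP C.hM hne hadj
        have hg : ∀ N ∈ cls, ∀ t, i ≤ t → t ≤ k → Cl N v t := fun N hN t h3 h4 =>
          (C.all_good t (by omega) (by omega)).all C.hM (hall t h3 h4).1 N hN
        have hch := chain_all C.hM hS (fun t => v (k - t)) (k - i) ?_ ?_ ?_ (k - i) le_rfl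
        · simp only [show k - (k - i) = i by omega] at hch
          exact (((hS N hN).blocked (hch.2 N hN) (adj_symm hsN.adj)).1 hch.1).not_arr hsN
        · intro N hN
          exact .base (hg N hN k h1 le_rfl).2
        · intro t ht; exact (hall _ (by omega) (by omega)).2
        · intro N hN t ht
          have := Cl.bidir (t := k - (t+1)) (hg N hN _ (by omega) (by omega))
            (hg N hN _ (by omega) (by omega))
          simp only [show k - (t+1) + 1 = k - t by omega] at this
          exact this.symm
      refine ⟨k, h1, h2, arr_trans C.anc hka hk.2 hadj, ?_, ?_, fun t ht1 ht2 => (hall t ht1 ht2).2.adj⟩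
      · intro h
        by_contra h3
        exact cyc1 C.anc h (not_arr_dir C.anc (adj_symm hka.adj) h3) hk.2
      · intro hk2
        have hok := C.ok' (i := k+1) (by omega) (by omega)
        rw [Nat.add_sub_cancel] at hok
        refine (ok_end C.anc hok.symm hk.2 (adj_symm hka.adj) hadj ?_).symm
        intro h
        refine hc ⟨by omega, ⟨?_, h.1.1⟩, h.2⟩
        simpa using h.1.2

end Ctx


theorem pathDistZ_Lf (M : PMG V) (Z : Finset V) (f : ℕ → V) (n : ℕ) :
    pathDistZ M Z (Lf f n) = ∑ t ∈ Finset.range (n+1),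
      if (t + 2 ≤ n ∧ M.Arr (f t) (f (t+1)) ∧ M.Arr (f (t+2)) (f (t+1))) then distZ M Z (f (t+1))
      else 0 := by
  unfold pathDistZ
  rw [Lf_length]
  apply Finset.sum_congr rfl
  intro t _
  by_cases h : t + 2 ≤ n ∧ M.Arr (f t) (f (t+1)) ∧ M.Arr (f (t+2)) (f (t+1))
  · rw [if_pos h, if_pos (Lf_coll.2 h), Lf_get, if_pos (by omega)]
    rfl
  · rw [if_neg h, if_neg (fun h' => h (Lf_coll.1 h'))]

theorem pathDistZ_lt {M : PMG V} {Z : Finset V} {v g : ℕ → V} {n i : ℕ} {s : V} (hi1 : 1 ≤ i)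
    (hi : i < n) (hg : ∀ t, t ≤ n → g t = if t = i then s else v t)
    (hcl : Cl M v i) (hlt : distZ M Z s < distZ M Z (v i))
    (hl : M.Arr s (v (i-1)) → M.Arr (v i) (v (i-1)))
    (hr : M.Arr s (v (i+1)) → M.Arr (v i) (v (i+1))) :
    pathDistZ M Z (Lf g n) < pathDistZ M Z (Lf v n) := by
  rw [pathDistZ_Lf, pathDistZ_Lf]
  have hclv : i - 1 + 2 ≤ n ∧ M.Arr (v (i-1)) (v (i-1+1)) ∧ M.Arr (v (i-1+2)) (v (i-1+1)) := by
    rw [show i - 1 + 2 = i + 1 by omega, show i - 1 + 1 = i by omega]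
    exact ⟨by omega, hcl⟩
  apply Finset.sum_lt_sum
  · intro t _
    by_cases h : t + 2 ≤ n ∧ M.Arr (g t) (g (t+1)) ∧ M.Arr (g (t+2)) (g (t+1))
    · rw [if_pos h]
      obtain ⟨h1, h2, h3⟩ := h
      rw [hg t (by omega), hg (t+1) (by omega)] at h2
      rw [hg (t+2) (by omega), hg (t+1) (by omega)] at h3
      rw [hg (t+1) (by omega)]
      by_cases c1 : t + 1 = i
      · obtain rfl : t = i - 1 := by omega
        rw [if_pos hclv, if_pos c1, c1]
        exact hlt.le
      · rw [if_neg c1] at h2 h3 ⊢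
        have hc : t + 2 ≤ n ∧ M.Arr (v t) (v (t+1)) ∧ M.Arr (v (t+2)) (v (t+1)) := by
          refine ⟨h1, ?_, ?_⟩
          · by_cases c2 : t = i
            · rw [if_pos c2] at h2
              rw [c2] at h2 ⊢
              exact hr h2
            · rwa [if_neg c2] at h2
          · by_cases c2 : t + 2 = i
            · rw [if_pos c2] at h3
              rw [show t + 1 = i - 1 by omega] at h3 ⊢
              rw [c2]
              exact hl h3
            · rwa [if_neg c2] at h3
        rw [if_pos hc]
    · rw [if_neg h]; exact Nat.zero_le _
  · refine ⟨i - 1, Finset.mem_range.2 (by omega), ?_⟩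
    rw [if_pos hclv, show i - 1 + 1 = i by omega]
    split_ifs with h
    · rw [hg i (by omega), if_pos rfl]; exact hlt
    · omega

namespace Ctx
variable {P : PMG V} {cls : Set (PMG V)} {M : PMG V} {X Y Z : Finset V} {v : ℕ → V} {n : ℕ}

theorem coll_contra (C : Ctx P cls M X Y Z v n)
    (hdist : ∀ g, Conn M Z g n → g 0 ∈ X → g n ∈ Y → (∀ i, 1 ≤ i → i ≤ n → g i ∉ X) →
      (∃ i, i < n ∧ M.Arr (g (i+1)) (g i)) → pathDistZ M Z (Lf v n) ≤ pathDistZ M Z (Lf g n))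
    {i : ℕ} (hi1 : 1 ≤ i) (hi : i < n) (hcl : Cl M v i) {s : V} (hs : M.DirEdge (v i) s)
    (hsA : An M Z s) (hlt : distZ M Z s < distZ M Z (v i)) {N : PMG V} (hN : N ∈ cls)
    (hsN : N.Arr s (v i)) : False := by
  have hii : ∀ t, i ≤ t → t ≤ i → Cl M v t ∧ M.DirEdge (v t) s := by
    intro t h1 h2
    obtain rfl : t = i := by omega
    exact ⟨hcl, hs⟩
  obtain ⟨j, L⟩ := C.lend_aux hi hN hsN i hi1 le_rfl hii
  obtain ⟨k, R⟩ := C.rend_aux hi1 hN hsN _ i le_rfl le_rfl hi hii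
  have hj1 := L.h1
  have hji := L.h2
  have hik := R.h1
  have hkn := R.h2
  by_cases hsX : s ∈ X
  · have hconn : Conn M Z (PMG.cat (fun _ => s) 0 (fun t => v (k + 1 + t))) (0 + 1 + (n - (k+1))) := by
      refine Conn.cat (Conn.single s) (C.conn.suffix (by omega)) (adj_symm R.arr.adj) ?_ (by omega) ?_
      · intro a b _ hb h
        exact C.vX (k+1+b) (by omega) (by omega) (h ▸ hsX)
      · intro h
        exact R.ok (by omega)
    have := C.short _ _ hconn (by rw [cat_le le_rfl]; exact hsX)
      (by rw [cat_add, show k + 1 + (n - (k+1)) = n by omega]; exact C.vn) ?_ ?_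
    · omega
    · intro t h1 h2
      rw [cat_ge (by omega)]
      exact C.vX _ (by omega) (by omega)
    · refine ⟨0, by omega, ?_⟩
      rw [cat_ge (by omega : 0 < 0 + 1), cat_le le_rfl]
      exact R.arr
  · by_cases hon : ∃ m, m ≤ n ∧ v m = s
    · obtain ⟨m, hm, rfl⟩ := hon
      have hnj : ∀ t, j ≤ t → t ≤ k → t ≠ m := by
        rintro t h1 h2 rfl
        by_cases h : t ≤ i
        · exact adj_ne (L.adj t h1 h) rfl
        · exact adj_ne (R.adj t (by omega) h2) rfl
      have hmj : m ≠ j - 1 := by rintro rfl; exact adj_ne L.arr.adj rfl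
      have hmk : m ≠ k + 1 := by rintro rfl; exact adj_ne R.arr.adj rfl
      by_cases hlt : m < j
      · rcases C.fail (l := m) (r := k+1) (by omega) (by omega) (adj_symm R.arr.adj) with
          ⟨_, h, _⟩ | ⟨h1, h2⟩ | ⟨h1, h2⟩
        · exact h.not_arr R.arr
        · have hok := C.ok' h1 (by omega)
          apply h2
          have := R.arr
          unfold Ok at *
          tauto
        · exact h2 (R.ok (by omega))
      · have hmk' : k + 1 < m := by
          by_contra h
          exact hnj m (by omega) (by omega) rfl
        rcases C.fail (l := j-1) (r := m) (by omega) (by omega) L.arr.adj with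
          ⟨h1, h2, h3⟩ | ⟨h1, h2⟩ | ⟨h1, h2⟩
        · exact (C.pforbM (by omega) hm h1 h2 h3).2.1 m le_rfl hm hsA
        · exact h2 (L.ok (by omega))
        · have hok := C.ok' (i := m) (by omega) h1
          apply h2
          have := L.arr
          unfold Ok at *
          tauto
    · have hon' : ∀ t, t ≤ n → v t ≠ s := fun t ht h => hon ⟨t, ht, h⟩
      have hc1 : Conn M Z (PMG.cat (fun _ => s) 0 (fun t => v (k + 1 + t))) (0 + 1 + (n - (k+1))) := by
        refine Conn.cat (Conn.single s) (C.conn.suffix (by omega)) (adj_symm R.arr.adj) ?_ (by omega) ?_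
        · intro a b _ hb h
          exact hon' (k+1+b) (by omega) h.symm
        · intro h
          exact R.ok (by omega)
      set g1 := PMG.cat (fun _ => s) 0 (fun t => v (k + 1 + t)) with hg1
      have g10 : g1 0 = s := by rw [hg1, cat_le le_rfl]
      have g1s : ∀ t, g1 (0 + 1 + t) = v (k + 1 + t) := fun t => by rw [hg1, cat_add]
      have hc2 : Conn M Z (PMG.cat v (j-1) g1) (j - 1 + 1 + (0 + 1 + (n - (k+1)))) := by
        refine Conn.cat (C.conn.initSeg (by omega)) hc1 (by rw [g10]; exact L.arr.adj) ?_ ?_ ?_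
        · intro a b ha hb
          by_cases h : b = 0
          · rw [h, g10]; exact hon' a (by omega)
          · rw [show b = 0 + 1 + (b - 1) by omega, g1s]
            exact C.ne' (by omega) (by omega) (by omega)
        · intro t ht
          rw [g10]
          have := L.ok (by omega)
          rwa [show j - 1 - 1 = t by omega] at this
        · intro _
          rw [g10, g1s 0]
          exact ⟨fun _ _ => hsA, fun h => absurd ⟨L.arr, R.arr⟩ h⟩
      set g := PMG.cat v (j-1) g1 with hgdef
      have gl : ∀ t, t < j → g t = v t := fun t ht => by rw [hgdef, cat_le (by omega)]
      have gj : g j = s := by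
        rw [hgdef, cat_ge (by omega), show j - (j - 1 + 1) = 0 by omega, g10]
      have gr : ∀ t, g (j + 1 + t) = v (k + 1 + t) := fun t => by
        rw [hgdef, cat_ge (by omega), show j + 1 + t - (j - 1 + 1) = 0 + 1 + t by omega, g1s]
      have hX : ∀ t, 1 ≤ t → t ≤ j - 1 + 1 + (0 + 1 + (n - (k+1))) → g t ∉ X := by
        intro t h1 h2
        rcases lt_trichotomy t j with h | h | h
        · rw [gl t h]; exact C.vX t h1 (by omega)
        · rw [h, gj]; exact hsX
        · rw [show t = j + 1 + (t - (j+1)) by omega, gr]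
          exact C.vX _ (by omega) (by omega)
      have h0 : g 0 ∈ X := by rw [gl 0 (by omega)]; exact C.v0
      have hY : g (j - 1 + 1 + (0 + 1 + (n - (k+1)))) ∈ Y := by
        rw [show j - 1 + 1 + (0 + 1 + (n - (k+1))) = j + 1 + (n - (k+1)) by omega, gr,
          show k + 1 + (n - (k+1)) = n by omega]
        exact C.vn
      have hnc : ∃ t, t < j - 1 + 1 + (0 + 1 + (n - (k+1))) ∧ M.Arr (g (t+1)) (g t) := by
        refine ⟨j, by omega, ?_⟩
        have := gr 0
        rw [add_zero, add_zero] at this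
        rw [this, gj]
        exact R.arr
      have hle := C.short _ _ hc2 h0 hY hX hnc
      obtain rfl : j = i := by omega
      obtain rfl : k = j := by omega
      rw [show k - 1 + 1 + (0 + 1 + (n - (k+1))) = n by omega] at *
      have hd := hdist g hc2 h0 hY hX hnc
      refine absurd (pathDistZ_lt hi1 hi ?_ hcl hlt L.imp R.imp) (not_lt.2 hd)
      intro t ht
      rcases lt_trichotomy t k with h | h | h
      · rw [gl t h, if_neg (by omega)]
      · rw [h, gj, if_pos rfl]
      · rw [show t = k + 1 + (t - (k+1)) by omega, gr, if_neg (by omega)]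

theorem coll_desc (C : Ctx P cls M X Y Z v n)
    (hdist : ∀ g, Conn M Z g n → g 0 ∈ X → g n ∈ Y → (∀ i, 1 ≤ i → i ≤ n → g i ∉ X) →
      (∃ i, i < n ∧ M.Arr (g (i+1)) (g i)) → pathDistZ M Z (Lf v n) ≤ pathDistZ M Z (Lf g n))
    {i : ℕ} (hi1 : 1 ≤ i) (hi : i < n) (hcl : Cl M v i) : ∃ z ∈ Z, Descendant P (v i) z := by
  by_cases hZ : v i ∈ Z
  · exact ⟨v i, hZ, desc_iff.2 .refl⟩
  · obtain ⟨s, hs, hsA, hd⟩ := distZ_step C.anc (C.cl_an hi1 hi hcl) hZ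
    have hPd : P.DirEdge (v i) s := by
      apply pag_dir_of C.hP C.hM
      intro N hN
      apply not_arr_dir (pag_anc C.hP hN) (adj_symm ((pag_adj2 C.hP C.hM hN).1 hs.adj))
      intro h
      exact C.coll_contra hdist hi1 hi hcl hs hsA (by omega) hN h
    obtain ⟨z, hz, hr⟩ := claimE C.hP C.hM _ (v i) s hPd hsA rfl hd
    exact ⟨z, hz, desc_iff.2 (.head hPd hr)⟩

theorem status_P (C : Ctx P cls M X Y Z v n) {i : ℕ} (hi1 : 1 ≤ i) (hi : i < n) :
    (P.Arr (v (i-1)) (v i) ∧ P.Arr (v (i+1)) (v i)) ∨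
    (P.mark (v (i-1)) (v i) = some Mark.tail ∨ P.mark (v (i+1)) (v i) = some Mark.tail ∨
      (P.mark (v (i-1)) (v i) = some Mark.circle ∧ P.mark (v (i+1)) (v i) = some Mark.circle ∧
        ¬ P.Adj (v (i-1)) (v (i+1)))) := by
  rcases C.all_good i hi1 hi with h | h | h | ⟨hn, h⟩
  · left
    exact ⟨pag_arr_of C.hP C.hM fun N hN => (h N hN).1, pag_arr_of C.hP C.hM fun N hN => (h N hN).2⟩
  · right; left; exact (pag_dir_of C.hP C.hM h).2
  · right; right; left; exact (pag_dir_of C.hP C.hM h).2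
  · by_cases h1 : P.Arr (v (i-1)) (v i)
    · right; right; left
      refine (pag_dir_of C.hP C.hM (a := v i) (b := v (i+1)) fun N hN => ?_).2
      apply not_arr_dir (pag_anc C.hP hN) (adj_symm ((pag_adj2 C.hP C.hM hN).1 (C.conn.adj i hi)))
      intro h2
      exact h N hN ⟨pag_arr C.hP hN h1, h2⟩
    · by_cases h2 : P.Arr (v (i+1)) (v i)
      · right; left
        refine (pag_dir_of C.hP C.hM (a := v i) (b := v (i-1)) fun N hN => ?_).2
        apply not_arr_dir (pag_anc C.hP hN) ((pag_adj2 C.hP C.hM hN).1 (C.adj' hi1 (by omega)))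
        intro h3
        exact h N hN ⟨h3, pag_arr C.hP hN h2⟩
      · right
        have a1 : P.Adj (v (i-1)) (v i) := (pag_adj C.hP C.hM).2 (C.adj' hi1 (by omega))
        have a2 : P.Adj (v (i+1)) (v i) := (pag_adj C.hP C.hM).2 (adj_symm (C.conn.adj i hi))
        obtain ⟨m1, e1⟩ := Option.isSome_iff_exists.1 a1
        obtain ⟨m2, e2⟩ := Option.isSome_iff_exists.1 a2
        have hn' : ¬ P.Adj (v (i-1)) (v (i+1)) := fun h => hn ((pag_adj C.hP C.hM).1 h)
        unfold Arr at h1 h2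
        cases m1 <;> cases m2 <;> simp_all

theorem not_cl_of_dnc (C : Ctx P cls M X Y Z v n) {i : ℕ} (hi1 : 1 ≤ i) (hi : i < n)
    (h : P.mark (v (i-1)) (v i) = some Mark.tail ∨ P.mark (v (i+1)) (v i) = some Mark.tail ∨
      (P.mark (v (i-1)) (v i) = some Mark.circle ∧ P.mark (v (i+1)) (v i) = some Mark.circle ∧
        ¬ P.Adj (v (i-1)) (v (i+1)))) : ¬ Cl M v i := by
  intro hc
  have hall := (C.all_good i hi1 hi).all C.hM hc
  have h1 : P.mark (v (i-1)) (v i) = some Mark.arrow :=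
    pag_arr_of C.hP C.hM fun N hN => (hall N hN).1
  have h2 : P.mark (v (i+1)) (v i) = some Mark.arrow :=
    pag_arr_of C.hP C.hM fun N hN => (hall N hN).2
  rw [h1, h2] at h
  simp at h

theorem nc_P (C : Ctx P cls M X Y Z v n) : ∃ i, i < n ∧ P.Arr (v (i+1)) (v i) := by
  by_contra hcon
  push Not at hcon
  obtain ⟨hA, hV⟩ := C.forb v n C.conn.adj C.conn.inj C.v0 C.vn C.vX hcon
  have hex := C.nc
  obtain ⟨h1, h2⟩ := Nat.find_spec hex
  have hmin : ∀ t, t < Nat.find hex → ¬ (t < n ∧ M.Arr (v (t+1)) (v t)) :=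
    fun t ht => Nat.find_min hex ht
  generalize Nat.find hex = i at *
  by_cases h0 : i = 0
  · subst h0
    exact (pag_dir C.hP C.hM hV.1).not_arr h2
  · refine hA i (by omega) (by omega) (C.cl_an (by omega) h1 ⟨?_, h2⟩)
    have := hmin (i-1) (by omega)
    rw [show i - 1 + 1 = i by omega] at this
    exact (not_arr_dir C.anc (adj_symm (C.adj' (by omega) (by omega)))
      (fun h => this ⟨by omega, h⟩)).1

theorem final (C : Ctx P cls M X Y Z v n)
    (hdist : ∀ g, Conn M Z g n → g 0 ∈ X → g n ∈ Y → (∀ i, 1 ≤ i → i ≤ n → g i ∉ X) →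
      (∃ i, i < n ∧ M.Arr (g (i+1)) (g i)) → pathDistZ M Z (Lf v n) ≤ pathDistZ M Z (Lf g n)) :
    ProperPath P X Y (Lf v n) ∧ DefStatus P (Lf v n) ∧ ¬ PossDirAlong P (Lf v n) ∧
      MConn P Z (Lf v n) := by
  have hds : DefStatus P (Lf v n) := by
    intro i hi
    rw [Lf_length] at hi
    rw [Lf_coll, Lf_dnc]
    rcases C.status_P (i := i+1) (by omega) (by omega) with h | h
    · left; exact ⟨by omega, h⟩
    · right; exact ⟨by omega, h⟩
  refine ⟨Lf_proper.2 ⟨⟨fun i hi => (pag_adj C.hP C.hM).2 (C.conn.adj i hi), C.conn.inj⟩,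
    C.v0, C.vn, C.vX⟩, hds, ?_, hds, ?_, ?_⟩
  · intro h
    obtain ⟨i, h1, h2⟩ := C.nc_P
    exact Lf_possDir.1 h i h1 h2
  · intro i b hb hd
    obtain ⟨h1, rfl⟩ := Lf_get_some.1 hb
    obtain ⟨h2, h3⟩ := Lf_dnc.1 hd
    have := C.not_cl_of_dnc (i := i+1) (by omega) (by omega) h3
    exact (C.conn.ok i h2).2 this
  · intro i b hb hd
    obtain ⟨h1, rfl⟩ := Lf_get_some.1 hb
    obtain ⟨h2, h3⟩ := Lf_coll.1 hd
    exact C.coll_desc hdist (i := i+1) (by omega) (by omega)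
      ⟨pag_arr C.hP C.hM h3.1, pag_arr C.hP C.hM h3.2⟩

end Ctx

end Helpers
end PMG

open PMG in
/-- Lemma 5.7: a shortest proper non-causal m-connecting path in a MAG, chosen with
minimal distance-from-`Z` among the equally short ones, corresponds to a proper
definite status non-causal path that is m-connecting given `Z` in its PAG. -/
theorem shortest_noncausal_mconn_is_mconn_in_pag {V : Type} [Fintype V] [DecidableEq V]
    (P : PMG V) (cls : Set (PMG V)) (hP : IsPAGOf P cls)
    (M : PMG V) (hM : M ∈ cls) (X Y Z : Finset V)
    (hXY : Disjoint X Y) (hXZ : Disjoint X Z) (hYZ : Disjoint Y Z)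
    (hX : X.Nonempty) (hY : Y.Nonempty)
    (hAm : Amenable P (Visible P) X Y)
    (hZforb : ∀ z ∈ Z, z ∉ Forb P X Y)
    (p : List V)
    (hprop : ProperPath M X Y p) (hnc : ¬ PossDirAlong M p) (hmc : MConn M Z p)
    (hshort : ∀ q, ProperPath M X Y q → ¬ PossDirAlong M q → MConn M Z q →
      p.length ≤ q.length)
    (hdist : ∀ q, ProperPath M X Y q → ¬ PossDirAlong M q → MConn M Z q →
      q.length = p.length → pathDistZ M Z p ≤ pathDistZ M Z q) :
    ProperPath P X Y p ∧ DefStatus P p ∧ ¬ PossDirAlong P p ∧ MConn P Z p := by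
  obtain ⟨v, n, rfl⟩ := exists_Lf p hprop.1.1
  have hA : IsAncestral M := pag_anc hP hM
  obtain ⟨⟨hadj, hinj⟩, h0, hn, hvX⟩ := Lf_proper.1 hprop
  have key : ∀ (g : ℕ → V) (m : ℕ), Conn M Z g m → g 0 ∈ X → g m ∈ Y →
      (∀ i, 1 ≤ i → i ≤ m → g i ∉ X) → (∃ i, i < m ∧ M.Arr (g (i+1)) (g i)) →
      ProperPath M X Y (Lf g m) ∧ ¬ PossDirAlong M (Lf g m) ∧ MConn M Z (Lf g m) := by
    intro g m hc a0 am aX ⟨i, hi, hia⟩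
    exact ⟨Lf_proper.2 ⟨⟨hc.adj, hc.inj⟩, a0, am, aX⟩, fun h => Lf_possDir.1 h i hi hia,
      (Lf_mconn hA hc.adj).2 hc.ok⟩
  have C : Ctx P cls M X Y Z v n := by
    refine ⟨hP, hM, hAm, hZforb, ⟨hadj, hinj, (Lf_mconn hA hadj).1 hmc⟩, h0, hn, hvX, ?_, ?_⟩
    · by_contra h
      push Not at h
      exact hnc (Lf_possDir.2 h)
    · intro g m hc a0 am aX anc
      obtain ⟨k1, k2, k3⟩ := key g m hc a0 am aX anc
      have := hshort _ k1 k2 k3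
      simp only [Lf_length] at this
      omega
  refine C.final ?_
  intro g hc a0 am aX anc
  obtain ⟨k1, k2, k3⟩ := key g n hc a0 am aX anc
  exact hdist _ k1 k2 k3 (by simp only [Lf_length])
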